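/- Let {X_n} be a stationary and ergodic time series with values in a finite or countably infinite set 𝒳. Then P(χ_n = K(X̃⁰_{−∞}) eventually | K(X̃⁰_{−∞}) < ∞) = 1 and P(lim_{n→∞} χ_n = ∞ | K(X̃⁰_{−∞}) = ∞) = 1. -/

import Mathlib

open MeasureTheory Filter Set
open scoped ENNReal Topology

noncomputable section

namespace MWPrediction

/-- The canonical two-sided path space for a process with values in `𝒳`. -/
abbrev Path (𝒳 : Type*) := ℤ → 𝒳

variable {𝒳 : Type*}

/-- The left shift `(T ω) i = ω (i+1)` on two-sided sequences. -/
def shift (ω : Path 𝒳) : Path 𝒳 := fun i => ω (i + 1)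

/-- The one-sided past `X⁰_{-∞}`, recorded as `past ω i = X_{-i}`. -/
def past (ω : Path 𝒳) : ℕ → 𝒳 := fun i => ω (-(i : ℤ))

/-- The string `s` of length `m` (read right-to-left: `s j` is the symbol at
position `t - j`) occurs in `ω` ending at time `t`. -/
def OccursAt (ω : Path 𝒳) (m : ℕ) (s : ℕ → 𝒳) (t : ℤ) : Prop :=
  ∀ j < m, ω (t - (j : ℤ)) = s j

/-- The auxiliary stopping times `ζ_n`:  `ζ_0 = 0` and `ζ_n` is obtained from
`ζ_{n-1}` by waiting for the recurrence of the block of length `l n` ending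
at `ζ_{n-1}`. -/
def zeta (l : ℕ → ℕ) (ω : Path 𝒳) : ℕ → ℤ
  | 0 => 0
  | n + 1 =>
    zeta l ω n +
      ((sInf {t : ℕ | 0 < t ∧ ∀ s < l (n + 1),
          ω (zeta l ω n - (s : ℤ) + (t : ℤ)) = ω (zeta l ω n - (s : ℤ))} : ℕ) : ℤ)

/-- `J n = min { j ≥ 1 : l (j+1) > n }`. -/
def Jfun (l : ℕ → ℕ) (n : ℕ) : ℕ := sInf {j : ℕ | 1 ≤ j ∧ n < l (j + 1)}

/-- The auxiliary process `X̃`: `tildePast l ω i = X̃_{-i} = X_{ζ_{J(i)} - i}`. -/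
def tildePast (l : ℕ → ℕ) (ω : Path 𝒳) : ℕ → 𝒳 :=
  fun i => ω (zeta l ω (Jfun l i) - (i : ℤ))

variable [MeasurableSpace 𝒳]

/-- `pstr μ m s = P(X_{-m+1}^0 = s)`, the probability that the string `s` of
length `m` (read right-to-left) occupies positions `-m+1, …, 0`.
(So `pstr μ (k+1)` is `p_k` of the paper.) -/
def pstr (μ : Measure (Path 𝒳)) (m : ℕ) (s : ℕ → 𝒳) : ℝ :=
  (μ {ω | ∀ j < m, ω (-(j : ℤ)) = s j}).toReal

/-- `pcond μ m y s = P(X_1 = y | X_{-m+1}^0 = s)`, conditioning on `m` symbols.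
(So `pcond μ m` is `p_{m-1}(·|·)` of the paper.) -/
def pcond (μ : Measure (Path 𝒳)) (m : ℕ) (y : 𝒳) (s : ℕ → 𝒳) : ℝ :=
  (μ {ω | ω 1 = y ∧ ∀ j < m, ω (-(j : ℤ)) = s j}).toReal / pstr μ m s

/-- Append `y` as the new rightmost symbol of the string `s`. -/
def withLast (y : 𝒳) (s : ℕ → 𝒳) : ℕ → 𝒳 := fun j => if j = 0 then y else s (j - 1)

/-- The string which agrees with `b` on its rightmost `k` symbols and continues
to the left with `z`:  this is the string `(z, b_{-k+1}^0)` of the paper. -/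
def prependOld (b : ℕ → 𝒳) (k : ℕ) (z : ℕ → 𝒳) : ℕ → 𝒳 :=
  fun j => if j < k then b j else z (j - k)

/-- `K` is a memory bound for the past `b`: for all `i ≥ 1`, `y` and `z ∈ 𝒳^i`,
if `p_{K+i}(z, b_{-K+1}^0, y) > 0` then
`p_{K-1}(y | b_{-K+1}^0) = p_{K+i-1}(y | z, b_{-K+1}^0)`. -/
def IsMemoryBound (μ : Measure (Path 𝒳)) (b : ℕ → 𝒳) (K : ℕ) : Prop :=
  ∀ i : ℕ, 1 ≤ i → ∀ y : 𝒳, ∀ z : ℕ → 𝒳,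
    0 < pstr μ (K + i + 1) (withLast y (prependOld b K z)) →
    pcond μ K y b = pcond μ (K + i) y (prependOld b K z)

/-- The (random) memory length `K(b)` of a one-sided path `b`: the smallest
memory bound, and `∞` if there is none. -/
def memLen (μ : Measure (Path 𝒳)) (b : ℕ → 𝒳) : ℕ∞ :=
  sInf {n : ℕ∞ | ∃ K : ℕ, n = (K : ℕ∞) ∧ IsMemoryBound μ b K}

/-- `Δ_k(b_{-k+1}^0)`. -/
def Delta (μ : Measure (Path 𝒳)) (k : ℕ) (b : ℕ → 𝒳) : ℝ :=
  sSup {d : ℝ | ∃ i : ℕ, 1 ≤ i ∧ ∃ z : ℕ → 𝒳, ∃ x : 𝒳,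
    0 < pstr μ (k + i + 1) (withLast x (prependOld b k z)) ∧
    d = |pcond μ k x b - pcond μ (k + i) x (prependOld b k z)|}

/-- `⌈n/2⌉`. -/
def half (n : ℕ) : ℕ := (n + 1) / 2

open Classical in
/-- The number of times `t ∈ [a, b]` at which the string `s` of length `m`
occurs in `ω` ending at `t`. -/
def cnt (ω : Path 𝒳) (m : ℕ) (s : ℕ → 𝒳) (a b : ℤ) : ℕ :=
  ((Finset.Icc a b).filter fun t => OccursAt ω m s t).card

/-- Membership in `ℒ_{n,m}^{(1)}`: the string `s` of length `m+1` occurs in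
`X_0^{⌈n/2⌉ - 1}`. -/
def inL1 (ω : Path 𝒳) (n m : ℕ) (s : ℕ → 𝒳) : Prop :=
  ∃ t : ℤ, (m : ℤ) ≤ t ∧ t ≤ (half n : ℤ) - 1 ∧ OccursAt ω (m + 1) s t

/-- Membership in `ℒ_{n,m}^{(2)}`: the string `s` of length `m+1` occurs more
than `n^{1-γ}` times in `X_{⌈n/2⌉}^n`. -/
def inL2 (γ : ℝ) (ω : Path 𝒳) (n m : ℕ) (s : ℕ → 𝒳) : Prop :=
  (n : ℝ) ^ (1 - γ) < (cnt ω (m + 1) s ((half n : ℤ) + (m : ℤ)) (n : ℤ) : ℝ)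

/-- Membership in `ℒ_m^n = ℒ_{n,m}^{(1)} ∩ ℒ_{n,m}^{(2)}`. -/
def inL (γ : ℝ) (ω : Path 𝒳) (n m : ℕ) (s : ℕ → 𝒳) : Prop :=
  inL1 ω n m s ∧ inL2 γ ω n m s

/-- The empirical conditional relative frequency of `x` following the string
`s` of length `m`, computed in the second half `X_{⌈n/2⌉}^n` of the data. -/
def empCond (ω : Path 𝒳) (n m : ℕ) (x : 𝒳) (s : ℕ → 𝒳) : ℝ :=
  (cnt ω (m + 1) (withLast x s) ((half n : ℤ) + (m : ℤ)) (n : ℤ) : ℝ) /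
    (cnt ω m s ((half n : ℤ) + (m : ℤ) - 1) ((n : ℤ) - 1) : ℝ)

/-- The empirical statistic `Δ̂_k^n(X̃_{-k+1}^0)`. -/
def hatDelta (γ : ℝ) (l : ℕ → ℕ) (ω : Path 𝒳) (n k : ℕ) : ℝ :=
  (if zeta l ω (Jfun l k) ≤ (half n : ℤ) - 1 then (1 : ℝ) else 0) *
    sSup {d : ℝ | ∃ i : ℕ, 1 ≤ i ∧ i ≤ n ∧ ∃ z : ℕ → 𝒳, ∃ x : 𝒳,
      inL γ ω n (k + i) (withLast x (prependOld (tildePast l ω) k z)) ∧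
      d = |empCond ω n k x (tildePast l ω) -
            empCond ω n (k + i) x (prependOld (tildePast l ω) k z)|}

/-- The order estimate `χ_n`: the smallest `0 ≤ k < n` with `Δ̂_k^n ≤ n^{-β}`
(and `χ_0 = 0`). -/
def chi (β γ : ℝ) (l : ℕ → ℕ) (ω : Path 𝒳) (n : ℕ) : ℕ :=
  sInf {k : ℕ | k < n ∧ hatDelta γ l ω n k ≤ (n : ℝ) ^ (-β)}

/-- The index `j` with `ζ_j ≤ v < ζ_{j+1}`. -/
def jIndex (l : ℕ → ℕ) (ω : Path 𝒳) (v : ℤ) : ℕ := sInf {j : ℕ | v < zeta l ω (j + 1)}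

/-- The stopping times `λ_n`:  `λ_0 = 0` and, if `ζ_j ≤ λ_{n-1} < ζ_{j+1}`,
`λ_n = min { t > λ_{n-1} : X_{t - χ_t + 1}^t = X_{ζ_j - χ_t + 1}^{ζ_j} }`. -/
def lambda (β γ : ℝ) (l : ℕ → ℕ) (ω : Path 𝒳) : ℕ → ℤ
  | 0 => 0
  | n + 1 =>
    lambda β γ l ω n + 1 +
      ((sInf {s : ℕ |
          ∀ r < chi β γ l ω (lambda β γ l ω n + 1 + (s : ℤ)).toNat,
            ω (lambda β γ l ω n + 1 + (s : ℤ) - (r : ℤ)) =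
              ω (zeta l ω (jIndex l ω (lambda β γ l ω n)) - (r : ℤ))} : ℕ) : ℤ)

/-- `κ_n = χ_{λ_n}`. -/
def kappa (β γ : ℝ) (l : ℕ → ℕ) (ω : Path 𝒳) (n : ℕ) : ℕ :=
  chi β γ l ω (lambda β γ l ω n).toNat

/-- The estimator `f_n = (1/n) ∑_{j=0}^{n-1} f(X_{λ_j + 1})`. -/
def fEst (β γ : ℝ) (l : ℕ → ℕ) (f : 𝒳 → ℝ) (ω : Path 𝒳) (n : ℕ) : ℝ :=
  (1 / (n : ℝ)) * ∑ j ∈ Finset.range n, f (ω (lambda β γ l ω j + 1))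

open Classical in
/-- The metric `d*` on one-sided sequences. -/
def dstar (x y : ℕ → 𝒳) : ℝ :=
  ∑' i : ℕ, (2 : ℝ)⁻¹ ^ (i + 1) * (if x i ≠ y i then 1 else 0)

/-- `F` restricted to `C` is continuous with respect to the metric `d*`. -/
def ContinuousOnDstar (F : (ℕ → 𝒳) → ℝ) (C : Set (ℕ → 𝒳)) : Prop :=
  ∀ x ∈ C, ∀ ε > 0, ∃ δ > 0, ∀ y ∈ C, dstar x y < δ → |F y - F x| < ε

/-- The σ-algebra generated by the one-sided past `X^0_{-∞}`. -/
def pastSigma (𝒳 : Type*) [MeasurableSpace 𝒳] : MeasurableSpace (Path 𝒳) :=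
  MeasurableSpace.comap past inferInstance

/-- `F` is a version of the conditional expectation `E(f(X_1) | X^0_{-∞})`. -/
def IsPredictor (μ : Measure (Path 𝒳)) (f : 𝒳 → ℝ) (F : (ℕ → 𝒳) → ℝ) : Prop :=
  (fun ω => F (past ω)) =ᵐ[μ] μ[fun ω => f (ω 1)|pastSigma 𝒳]

/-- `F` (a version of `E(f(X_1)|X^0_{-∞})`) is almost surely continuous:
it is continuous w.r.t. `d*` on a set of paths of probability one. -/
def ASContinuousCondExp (μ : Measure (Path 𝒳)) (F : (ℕ → 𝒳) → ℝ) : Prop :=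
  ∃ C : Set (ℕ → 𝒳), μ (past ⁻¹' C) = 1 ∧ ContinuousOnDstar F C

/-- The observation `(λ_j, X_0^{λ_j})`, encoding the data segment available at
time `λ_j` (values before time `0` are clamped to `X_0`). -/
def segObs (β γ : ℝ) (l : ℕ → ℕ) (j : ℕ) (ω : Path 𝒳) : ℤ × (ℕ → 𝒳) :=
  (lambda β γ l ω j, fun i => ω (max (lambda β γ l ω j - (i : ℤ)) 0))

/-- The σ-algebra generated by `(λ_j, X_0^{λ_j})`. -/
def segSigma (β γ : ℝ) (l : ℕ → ℕ) (j : ℕ) : MeasurableSpace (Path 𝒳) :=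
  MeasurableSpace.comap (segObs β γ l j) inferInstance

/-- The observation `(λ_j, X_{-∞}^{λ_j})`: the full past at time `λ_j`. -/
def fullPastObs (β γ : ℝ) (l : ℕ → ℕ) (j : ℕ) (ω : Path 𝒳) : ℤ × (ℕ → 𝒳) :=
  (lambda β γ l ω j, fun i => ω (lambda β γ l ω j - (i : ℤ)))

/-- The σ-algebra generated by `(λ_j, X_{-∞}^{λ_j})`. -/
def fullPastSigma (β γ : ℝ) (l : ℕ → ℕ) (j : ℕ) : MeasurableSpace (Path 𝒳) :=
  MeasurableSpace.comap (fullPastObs β γ l j) inferInstance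

/-- The `n`-th term `-(1/(n+1)) ∑ p log₂ p` of the entropy rate. -/
def entropyTerm (μ : Measure (Path 𝒳)) (n : ℕ) : ℝ :=
  -(1 / ((n : ℝ) + 1)) *
    ∑' s : Fin (n + 1) → 𝒳,
      pstr μ (n + 1) (fun j => if h : j < n + 1 then s ⟨j, h⟩ else s ⟨0, Nat.succ_pos n⟩) *
        Real.logb 2
          (pstr μ (n + 1) (fun j => if h : j < n + 1 then s ⟨j, h⟩ else s ⟨0, Nat.succ_pos n⟩))

/-- The process has entropy rate `H`. -/
def HasEntropyRate (μ : Measure (Path 𝒳)) (H : ℝ) : Prop :=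
  Tendsto (entropyTerm μ) atTop (nhds H)

/-- The backward stopping times `ζ̂_i^k`. -/
def hatZeta (l : ℕ → ℕ) (k : ℕ) (ω : Path 𝒳) : ℕ → ℤ
  | 0 => 0
  | i + 1 =>
    hatZeta l k ω i -
      ((sInf {t : ℕ | 0 < t ∧ ∀ s < l (k - i),
          ω (hatZeta l k ω i - (s : ℤ) - (t : ℤ)) = ω (hatZeta l k ω i - (s : ℤ))} : ℕ) : ℤ)

/-- The running maximum `max_{0 ≤ k ≤ n} ∑_{t < k} g (T^t x)`, in recursive form. -/
def maxBirkhoff {α : Type*} (T : α → α) (g : α → ℝ) : ℕ → α → ℝ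
  | 0 => fun _ => 0
  | n + 1 => fun x => max 0 (g x + maxBirkhoff T g n (T x))

section Birkhoff

variable {α : Type*} {T : α → α} {g : α → ℝ}

lemma maxBirkhoff_nonneg (n : ℕ) (x : α) : 0 ≤ maxBirkhoff T g n x := by
  cases n <;> simp [maxBirkhoff]

lemma maxBirkhoff_mono (n : ℕ) (x : α) : maxBirkhoff T g n x ≤ maxBirkhoff T g (n + 1) x := by
  induction n generalizing x with
  | zero => exact maxBirkhoff_nonneg 1 x
  | succ n ih => exact max_le_max le_rfl (by gcongr; exact ih (T x))

lemma maxBirkhoff_le {C : ℝ} (hC : ∀ x, |g x| ≤ C) (n : ℕ) (x : α) :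
    maxBirkhoff T g n x ≤ n * C := by
  have hC0 : 0 ≤ C := (abs_nonneg _).trans (hC x)
  induction n generalizing x with
  | zero => simp [maxBirkhoff]
  | succ n ih =>
    have h1 := (abs_le.1 (hC x)).2
    have h2 := ih (T x)
    refine max_le (by positivity) ?_
    push_cast
    linarith

lemma birkhoffSum_le_maxBirkhoff (n : ℕ) (x : α) :
    birkhoffSum T g n x ≤ maxBirkhoff T g n x := by
  induction n generalizing x with
  | zero => simp [maxBirkhoff]
  | succ n ih =>
    rw [birkhoffSum_succ']
    exact le_max_of_le_right (by gcongr; exact ih (T x))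

variable [MeasurableSpace α] {μ : Measure α}

lemma measurable_maxBirkhoff (hT : Measurable T) (hg : Measurable g) (n : ℕ) :
    Measurable (maxBirkhoff T g n) := by
  induction n with
  | zero => exact measurable_const
  | succ n ih => exact measurable_const.max (hg.add (ih.comp hT))

lemma bddAbove_birkhoffSum_of_integral_neg [IsProbabilityMeasure μ] (hT : Ergodic T μ)
    (hg : Measurable g) {C : ℝ} (hC : ∀ x, |g x| ≤ C) (hneg : ∫ x, g x ∂μ < 0) :
    ∀ᵐ x ∂μ, ∃ B : ℝ, ∀ n, birkhoffSum T g n x ≤ B := by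
  set F := maxBirkhoff T g with hF
  have hFm := measurable_maxBirkhoff hT.measurable hg
  set E : Set α := {x | ∀ N : ℕ, ∃ n, (N : ℝ) < F n x} with hE
  have hEm : MeasurableSet E := by
    simp only [hE, ofPred_forall, ofPred_exists]
    exact .iInter fun N => .iUnion fun n => measurableSet_lt measurable_const (hFm n)
  have hmono : ∀ x, Monotone fun n => F n x := fun x =>
    monotone_nat_of_le_succ fun n => maxBirkhoff_mono n x
  have hinv : T ⁻¹' E = E := by
    ext x
    constructor
    · intro h N
      obtain ⟨M, hM⟩ := exists_nat_gt ((N : ℝ) - g x)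
      obtain ⟨n, hn⟩ := h M
      exact ⟨n + 1, lt_max_of_lt_right (by linarith)⟩
    · intro h N
      obtain ⟨M, hM⟩ := exists_nat_gt ((N : ℝ) + g x)
      obtain ⟨n, hn⟩ := h M
      have hn' : (M : ℝ) < F (n + 1) x := hn.trans_le (maxBirkhoff_mono n x)
      rcases lt_max_iff.1 hn' with h0 | h0
      · exact absurd h0 (not_lt.2 M.cast_nonneg)
      · exact ⟨n, by linarith⟩
  rcases hT.toPreErgodic.ae_mem_or_ae_notMem hEm hinv with h | h
  · exfalso
    set H : ℕ → α → ℝ := fun n x => max (-F n (T x)) (g x) with hH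
    have hint : ∀ n, Integrable (F n) μ := fun n =>
      .of_bound (hFm n).aestronglyMeasurable (n * C) (.of_forall fun x => by
        rw [Real.norm_eq_abs, abs_of_nonneg (maxBirkhoff_nonneg n x)]
        exact maxBirkhoff_le hC n x)
    have hH0 : ∀ n, 0 ≤ ∫ x, H n x ∂μ := by
      intro n
      have e : ∀ x, H n x = F (n + 1) x - F n (T x) := by
        intro x
        simp only [hH, hF, maxBirkhoff]
        rw [← max_sub_sub_right]
        congr 1 <;> ring
      have hi : Integrable (fun x => F n (T x)) μ :=
        hT.toMeasurePreserving.integrable_comp_of_integrable (hint n)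
      have hcomp : ∫ x, F n (T x) ∂μ = ∫ x, F n x ∂μ := by
        rw [← integral_map hT.measurable.aemeasurable (hT.map_eq ▸ (hFm n).aestronglyMeasurable),
          hT.map_eq]
      simp_rw [e]
      rw [integral_sub (hint _) hi, hcomp, sub_nonneg]
      exact integral_mono (hint _) (hint _) fun x => maxBirkhoff_mono n x
    have hlim : Tendsto (fun n => ∫ x, H n x ∂μ) atTop (𝓝 (∫ x, g x ∂μ)) := by
      refine tendsto_integral_of_dominated_convergence (fun _ => C)
        (fun n => (((hFm n).comp hT.measurable).neg.max hg).aestronglyMeasurable)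
        (integrable_const C) (fun n => .of_forall fun x => ?_) ?_
      · have h1 := abs_le.1 (hC x)
        have h2 : 0 ≤ F n (T x) := maxBirkhoff_nonneg n (T x)
        rw [Real.norm_eq_abs, abs_le]
        exact ⟨h1.1.trans (le_max_right _ _), max_le (by linarith) h1.2⟩
      · filter_upwards [h] with x hx
        refine tendsto_const_nhds.congr' ?_
        have hx' : T x ∈ E := by rwa [← mem_preimage, hinv]
        obtain ⟨M, hM⟩ := exists_nat_gt (-g x)
        obtain ⟨n, hn⟩ := hx' M
        filter_upwards [eventually_ge_atTop n] with k hk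
        have : F n (T x) ≤ F k (T x) := hmono (T x) hk
        exact (max_eq_right (by linarith)).symm
    exact absurd (ge_of_tendsto' hlim hH0) (not_le.2 hneg)
  · filter_upwards [h] with x hx
    simp only [hE, mem_ofPred_eq, not_forall, not_exists, not_lt] at hx
    obtain ⟨N, hN⟩ := hx
    exact ⟨N, fun n => (birkhoffSum_le_maxBirkhoff n x).trans (hN n)⟩

lemma birkhoffSum_le_of_ergodic [IsProbabilityMeasure μ] (hT : Ergodic T μ)
    (hg : Measurable g) {C : ℝ} (hC : ∀ x, |g x| ≤ C) :
    ∀ᵐ x ∂μ, ∀ k : ℕ, ∃ B : ℝ, ∀ n : ℕ,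
      birkhoffSum T g n x ≤ n * (∫ x, g x ∂μ + 1 / ((k : ℝ) + 1)) + B := by
  rw [ae_all_iff]
  intro k
  set c := ∫ x, g x ∂μ + 1 / ((k : ℝ) + 1) with hc
  have hk : (0 : ℝ) < 1 / ((k : ℝ) + 1) := by positivity
  have hi : Integrable g μ := .of_bound hg.aestronglyMeasurable C (.of_forall hC)
  have h := bddAbove_birkhoffSum_of_integral_neg (g := fun x => g x - c) hT
    (hg.sub measurable_const) (C := C + |c|)
    (fun x => (abs_sub _ _).trans (by gcongr; exact hC x))
    (by rw [integral_sub hi (integrable_const c)]; simp [hc]; positivity)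
  filter_upwards [h] with x ⟨B, hB⟩
  refine ⟨B, fun n => ?_⟩
  have := hB n
  simp only [birkhoffSum, Finset.sum_sub_distrib, Finset.sum_const, Finset.card_range,
    nsmul_eq_mul] at this ⊢
  linarith

/-- Birkhoff's pointwise ergodic theorem for bounded measurable functions. -/
theorem tendsto_birkhoffSum_div [IsProbabilityMeasure μ] (hT : Ergodic T μ)
    (hg : Measurable g) {C : ℝ} (hC : ∀ x, |g x| ≤ C) :
    ∀ᵐ x ∂μ, Tendsto (fun n : ℕ => birkhoffSum T g n x / n) atTop (𝓝 (∫ x, g x ∂μ)) := by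
  have h2 := birkhoffSum_le_of_ergodic (g := fun x => - g x) hT hg.neg (C := C)
    (fun x => by simpa using hC x)
  filter_upwards [birkhoffSum_le_of_ergodic hT hg hC, h2] with x h1 h2
  rw [integral_neg] at h2
  rw [Metric.tendsto_atTop']
  intro ε hε
  obtain ⟨k, hk⟩ := exists_nat_one_div_lt (half_pos hε)
  obtain ⟨B, hB⟩ := h1 k
  obtain ⟨B', hB'⟩ := h2 k
  obtain ⟨N, hN⟩ := exists_nat_gt (max B B' / (ε / 2))
  refine ⟨N, fun n hn => ?_⟩
  have hn0 : (0 : ℝ) < n := by exact_mod_cast (Nat.zero_le N).trans_lt hn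
  have hmax : max B B' < n * (ε / 2) := by
    rw [div_lt_iff₀ (by positivity)] at hN
    have : (N : ℝ) < n := by exact_mod_cast hn
    nlinarith
  have hb1 := (le_max_left B B').trans_lt hmax
  have hb2 := (le_max_right B B').trans_lt hmax
  have e : birkhoffSum T (fun x => - g x) n x = - birkhoffSum T g n x := by
    simp [birkhoffSum]
  have i1 := hB n
  have i2 := hB' n
  rw [e] at i2
  have hk' : n * (1 / ((k : ℝ) + 1)) < n * (ε / 2) := by gcongr
  rw [Real.dist_eq, abs_lt, lt_sub_iff_add_lt, sub_lt_iff_lt_add, lt_div_iff₀ hn0,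
    div_lt_iff₀ hn0]
  constructor <;> nlinarith

end Birkhoff

section Strings

variable {𝒳 : Type*}

lemma shift_iterate (t : ℕ) (ω : Path 𝒳) (i : ℤ) : (shift^[t] ω) i = ω (i + t) := by
  induction t generalizing ω with
  | zero => simp
  | succ t ih =>
    rw [Function.iterate_succ_apply, ih, shift]
    push_cast
    ring_nf

lemma occursAt_congr {ω : Path 𝒳} {m : ℕ} {s s' : ℕ → 𝒳} (h : ∀ j < m, s j = s' j) (t : ℤ) :
    OccursAt ω m s t ↔ OccursAt ω m s' t := by
  unfold OccursAt
  exact forall₂_congr fun j hj => by rw [h j hj]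

lemma OccursAt.mono {ω : Path 𝒳} {m m' : ℕ} {s : ℕ → 𝒳} {t : ℤ} (h : OccursAt ω m s t)
    (hm : m' ≤ m) : OccursAt ω m' s t := fun j hj => h j (hj.trans_le hm)

lemma occursAt_withLast {ω : Path 𝒳} {m : ℕ} {s : ℕ → 𝒳} {x : 𝒳} {t : ℤ} :
    OccursAt ω (m + 1) (withLast x s) (t + 1) ↔ ω (t + 1) = x ∧ OccursAt ω m s t := by
  constructor
  · refine fun h => ⟨by simpa [withLast] using h 0 m.succ_pos, fun j hj => ?_⟩
    have := h (j + 1) (by omega)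
    simp only [withLast, Nat.succ_ne_zero, if_false, Nat.add_sub_cancel] at this
    rw [← this]
    congr 1
    push_cast
    ring
  · rintro ⟨h0, h⟩ j hj
    rcases j with _ | j
    · simpa [withLast] using h0
    · have := h j (by omega)
      simp only [withLast, Nat.succ_ne_zero, if_false, Nat.add_sub_cancel]
      rw [← this]
      congr 1
      push_cast
      ring

lemma occursAt_shift_iterate {ω : Path 𝒳} {m : ℕ} {s : ℕ → 𝒳} {t : ℤ} {u : ℕ} :
    OccursAt (shift^[u] ω) m s t ↔ OccursAt ω m s (t + u) := by
  unfold OccursAt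
  refine forall₂_congr fun j _ => ?_
  rw [shift_iterate, sub_add_eq_add_sub]

/-- Extend a finite string by a constant symbol. -/
def extendStr (x₀ : 𝒳) {m : ℕ} (σ : Fin m → 𝒳) : ℕ → 𝒳 :=
  fun j => if h : j < m then σ ⟨j, h⟩ else x₀

lemma extendStr_restrict (x₀ : 𝒳) (m : ℕ) (s : ℕ → 𝒳) {j : ℕ} (hj : j < m) :
    extendStr x₀ (fun i : Fin m => s i) j = s j := by
  simp [extendStr, hj]

open Classical in
lemma cnt_eq_sum (ω : Path 𝒳) (m : ℕ) (s : ℕ → 𝒳) (a : ℤ) (L : ℕ) :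
    cnt ω m s a (a + L - 1) =
      ∑ j ∈ Finset.range L, if OccursAt ω m s (a + j) then 1 else 0 := by
  have : Finset.Icc a (a + L - 1) = (Finset.range L).image fun j : ℕ => a + (j : ℤ) := by
    ext t
    simp only [Finset.mem_Icc, Finset.mem_image, Finset.mem_range]
    constructor
    · rintro ⟨h1, h2⟩
      exact ⟨(t - a).toNat, by omega, by omega⟩
    · rintro ⟨j, hj, rfl⟩
      omega
  rw [cnt, this, Finset.card_filter, Finset.sum_image (by intro i _ j _; simp)]

lemma cnt_add (ω : Path 𝒳) (m : ℕ) (s : ℕ → 𝒳) (a : ℤ) (L L' : ℕ) :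
    cnt ω m s a (a + (L + L' : ℕ) - 1) =
      cnt ω m s a (a + L - 1) + cnt ω m s (a + L) (a + L + L' - 1) := by
  rw [cnt_eq_sum, cnt_eq_sum, cnt_eq_sum, Finset.sum_range_add]
  congr 1
  refine Finset.sum_congr rfl fun j _ => ?_
  rw [Nat.cast_add, add_assoc]

lemma cnt_withLast_le (ω : Path 𝒳) (m : ℕ) (s : ℕ → 𝒳) (x : 𝒳) (a : ℤ) (L : ℕ) :
    cnt ω (m + 1) (withLast x s) (a + 1) (a + 1 + L - 1) ≤ cnt ω m s a (a + L - 1) := by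
  rw [cnt_eq_sum, cnt_eq_sum]
  refine Finset.sum_le_sum fun j _ => ?_
  rw [show a + 1 + (j : ℤ) = a + j + 1 by ring, occursAt_withLast]
  split_ifs <;> simp_all

lemma cnt_mono_string {ω : Path 𝒳} {m m' : ℕ} (s : ℕ → 𝒳) {a a' b : ℤ} (hm : m ≤ m')
    (ha : a ≤ a') : cnt ω m' s a' b ≤ cnt ω m s a b := by
  classical
  unfold cnt
  refine Finset.card_le_card fun t ht => ?_
  simp only [Finset.mem_filter, Finset.mem_Icc] at ht ⊢
  exact ⟨⟨ha.trans ht.1.1, ht.1.2⟩, ht.2.mono hm⟩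

lemma cnt_congr {ω : Path 𝒳} {m : ℕ} {s s' : ℕ → 𝒳} (h : ∀ j < m, s j = s' j) (a b : ℤ) :
    cnt ω m s a b = cnt ω m s' a b := by
  classical
  unfold cnt
  simp only [occursAt_congr h]

lemma withLast_congr {m : ℕ} {s s' : ℕ → 𝒳} (h : ∀ j < m, s j = s' j) (x : 𝒳) :
    ∀ j < m + 1, withLast x s j = withLast x s' j := by
  rintro (_ | j) hj
  · rfl
  · exact h j (by omega)

lemma prependOld_congr {k : ℕ} {b b' : ℕ → 𝒳} (h : ∀ j < k, b j = b' j) (z : ℕ → 𝒳) :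
    prependOld b k z = prependOld b' k z := by
  funext j
  unfold prependOld
  split_ifs with hj
  · exact h j hj
  · rfl

/-- The relative frequency is a genuine frequency. -/
lemma empCond_mem_Icc (ω : Path 𝒳) {n m : ℕ} (h : half n + m ≤ n + 1) (x : 𝒳) (s : ℕ → 𝒳) :
    empCond ω n m x s ∈ Icc (0 : ℝ) 1 := by
  obtain ⟨L, hL⟩ := Nat.exists_eq_add_of_le h
  refine ⟨by unfold empCond; positivity, ?_⟩
  have := cnt_withLast_le ω m s x ((half n : ℤ) + m - 1) L
  rw [show ((half n : ℤ) + m - 1) + 1 = half n + m by ring,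
    show (half n : ℤ) + m + L - 1 = n by omega,
    show (half n : ℤ) + m - 1 + L - 1 = n - 1 by omega] at this
  exact div_le_one_of_le₀ (by exact_mod_cast this) (by positivity)

end Strings

section Stationary

variable {𝒳 : Type*} [MeasurableSpace 𝒳]

lemma measurableSet_occursAt [MeasurableSingletonClass 𝒳] (m : ℕ) (s : ℕ → 𝒳) (t : ℤ) :
    MeasurableSet {ω : Path 𝒳 | OccursAt ω m s t} := by
  simp only [OccursAt, ofPred_forall]
  refine .iInter fun j => .iInter fun _ => ?_
  have h : Measurable fun ω : Path 𝒳 => ω (t - (j : ℤ)) := measurable_pi_apply _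
  exact h (measurableSet_singleton (s j))

lemma pstr_eq (μ : Measure (Path 𝒳)) (m : ℕ) (s : ℕ → 𝒳) :
    pstr μ m s = μ.real {ω | OccursAt ω m s 0} := by
  simp [pstr, OccursAt, Measure.real]

lemma pstr_congr (μ : Measure (Path 𝒳)) {m : ℕ} {s s' : ℕ → 𝒳} (h : ∀ j < m, s j = s' j) :
    pstr μ m s = pstr μ m s' := by
  simp only [pstr_eq, occursAt_congr h]

lemma pstr_nonneg (μ : Measure (Path 𝒳)) (m : ℕ) (s : ℕ → 𝒳) : 0 ≤ pstr μ m s :=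
  ENNReal.toReal_nonneg

variable [MeasurableSingletonClass 𝒳] {μ : Measure (Path 𝒳)}

lemma measureReal_occursAt (hμ : MeasurePreserving (shift : Path 𝒳 → Path 𝒳) μ μ) (m : ℕ)
    (s : ℕ → 𝒳) (t : ℕ) : μ.real {ω | OccursAt ω m s t} = pstr μ m s := by
  rw [pstr_eq, ← (hμ.iterate t).measureReal_preimage
    (measurableSet_occursAt m s 0).nullMeasurableSet]
  congr 1
  ext ω
  simp [occursAt_shift_iterate]

lemma pcond_eq (hμ : MeasurePreserving (shift : Path 𝒳 → Path 𝒳) μ μ) (m : ℕ) (y : 𝒳)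
    (s : ℕ → 𝒳) : pcond μ m y s = pstr μ (m + 1) (withLast y s) / pstr μ m s := by
  rw [← measureReal_occursAt hμ (m + 1) (withLast y s) 1, pcond, Measure.real]
  congr 4
  ext ω
  have := occursAt_withLast (ω := ω) (m := m) (s := s) (x := y) (t := 0)
  simp only [zero_add] at this
  rw [Nat.cast_one, this]
  simp [OccursAt]

lemma pcond_congr (hμ : MeasurePreserving (shift : Path 𝒳 → Path 𝒳) μ μ) {m : ℕ} (y : 𝒳)
    {s s' : ℕ → 𝒳} (h : ∀ j < m, s j = s' j) : pcond μ m y s = pcond μ m y s' := by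
  rw [pcond_eq hμ, pcond_eq hμ, pstr_congr μ h, pstr_congr μ (withLast_congr h y)]

lemma IsMemoryBound.congr (hμ : MeasurePreserving (shift : Path 𝒳 → Path 𝒳) μ μ) {K : ℕ}
    {b b' : ℕ → 𝒳} (h : ∀ j < K, b j = b' j) (hb : IsMemoryBound μ b K) :
    IsMemoryBound μ b' K := by
  intro i hi y z hz
  rw [← prependOld_congr h] at hz ⊢
  rw [← pcond_congr hμ y h]
  exact hb i hi y z hz

lemma pstr_withLast_le [IsFiniteMeasure μ]
    (hμ : MeasurePreserving (shift : Path 𝒳 → Path 𝒳) μ μ) (m : ℕ)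
    (y : 𝒳) (s : ℕ → 𝒳) : pstr μ (m + 1) (withLast y s) ≤ pstr μ m s := by
  rw [← measureReal_occursAt hμ (m + 1) (withLast y s) 1, pstr_eq]
  refine measureReal_mono fun ω hω => ?_
  have := (occursAt_withLast (t := 0)).1 (by simpa using hω)
  exact this.2

lemma pcond_mem_Icc [IsFiniteMeasure μ]
    (hμ : MeasurePreserving (shift : Path 𝒳 → Path 𝒳) μ μ) (m : ℕ) (x : 𝒳)
    (s : ℕ → 𝒳) : pcond μ m x s ∈ Icc (0 : ℝ) 1 := by
  rw [pcond_eq hμ]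
  exact ⟨div_nonneg (pstr_nonneg _ _ _) (pstr_nonneg _ _ _),
    div_le_one_of_le₀ (pstr_withLast_le hμ m x s) (pstr_nonneg _ _ _)⟩

variable [Countable 𝒳]

lemma hasSum_pstr_withLast [IsFiniteMeasure μ]
    (hμ : MeasurePreserving (shift : Path 𝒳 → Path 𝒳) μ μ) (m : ℕ) (s : ℕ → 𝒳) :
    HasSum (fun y => pstr μ (m + 1) (withLast y s)) (pstr μ m s) := by
  have hset : ∀ y, {ω : Path 𝒳 | OccursAt ω (m + 1) (withLast y s) 1} =
      {ω | ω 1 = y} ∩ {ω | OccursAt ω m s 0} := by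
    intro y
    ext ω
    simpa using occursAt_withLast (ω := ω) (m := m) (s := s) (x := y) (t := 0)
  have hU : {ω : Path 𝒳 | OccursAt ω m s 0} =
      ⋃ y, {ω : Path 𝒳 | OccursAt ω (m + 1) (withLast y s) 1} := by
    ext ω
    simp [hset]
  have hd : Pairwise (Function.onFun Disjoint fun y =>
      {ω : Path 𝒳 | OccursAt ω (m + 1) (withLast y s) 1}) := by
    intro y y' hy
    simp only [Function.onFun, hset]
    exact Set.disjoint_left.2 fun ω h h' => hy (h.1.symm.trans h'.1)
  have e := measure_iUnion (μ := μ) hd fun y => measurableSet_occursAt (m + 1) (withLast y s) 1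
  have hfin : ∑' y, μ {ω : Path 𝒳 | OccursAt ω (m + 1) (withLast y s) 1} ≠ ∞ := by
    rw [← e]
    exact measure_ne_top _ _
  simp_rw [← measureReal_occursAt hμ (m + 1) _ 1]
  rw [pstr_eq, hU, Measure.real, e, ENNReal.tsum_toReal_eq fun _ => measure_ne_top _ _]
  exact_mod_cast ENNReal.hasSum_toReal hfin

/-- If `K` is a memory bound, longer pasts do not change the conditional distribution. -/
lemma IsMemoryBound.pstr_withLast [IsFiniteMeasure μ]
    (hμ : MeasurePreserving (shift : Path 𝒳 → Path 𝒳) μ μ) {K M : ℕ} {b : ℕ → 𝒳}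
    (hb : IsMemoryBound μ b K) (hM : K < M) (x : 𝒳) :
    pstr μ (M + 1) (withLast x b) = pcond μ K x b * pstr μ M b := by
  have hw : prependOld b K (fun j => b (j + K)) = b := by
    funext j
    unfold prependOld
    split_ifs with h
    · rfl
    · simp only; congr 1; omega
  have key : ∀ y, 0 < pstr μ (M + 1) (withLast y b) → pcond μ K y b = pcond μ M y b := by
    intro y hy
    obtain ⟨i, rfl⟩ := Nat.exists_eq_add_of_le hM.le
    have := hb i (by omega) y (fun j => b (j + K))
    rw [hw] at this
    exact this hy
  rcases (pstr_nonneg μ M b).eq_or_lt with h0 | h0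
  · have := pstr_withLast_le hμ M x b
    rw [← h0] at this ⊢
    rw [mul_zero]
    exact le_antisymm this (pstr_nonneg _ _ _)
  have hKpos : 0 < pstr μ K b := by
    refine h0.trans_le ?_
    rw [pstr_eq, pstr_eq]
    exact measureReal_mono fun ω hω => hω.mono hM.le
  have h1 : HasSum (fun y => pcond μ M y b) 1 := by
    simp_rw [pcond_eq hμ]
    simpa [h0.ne'] using (hasSum_pstr_withLast hμ M b).div_const (pstr μ M b)
  have h2 : HasSum (fun y => pcond μ K y b) 1 := by
    simp_rw [pcond_eq hμ]
    simpa [hKpos.ne'] using (hasSum_pstr_withLast hμ K b).div_const (pstr μ K b)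
  have hle : ∀ y, 0 ≤ pcond μ K y b - pcond μ M y b := by
    intro y
    rcases (pstr_nonneg μ (M + 1) (withLast y b)).eq_or_lt with h | h
    · rw [pcond_eq hμ M, ← h, zero_div, sub_zero, pcond_eq hμ]
      exact div_nonneg (pstr_nonneg _ _ _) (pstr_nonneg _ _ _)
    · rw [key y h, sub_self]
  have h3 := h2.sub h1
  rw [sub_self, hasSum_zero_iff_of_nonneg hle] at h3
  have h4 : pcond μ K x b = pcond μ M x b := sub_eq_zero.1 (congrFun h3 x)
  rw [h4, pcond_eq hμ, div_mul_cancel₀ _ h0.ne']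

end Stationary

section Frequencies

lemma tendsto_div_of_abs_sub_le {u : ℕ → ℝ} {r C : ℝ} (h : ∀ n : ℕ, |u n - r * n| ≤ C) :
    Tendsto (fun n : ℕ => u n / n) atTop (𝓝 r) := by
  rw [tendsto_iff_norm_sub_tendsto_zero]
  refine squeeze_zero' (.of_forall fun _ => norm_nonneg _) ?_
    (tendsto_const_div_atTop_nhds_zero_nat C)
  filter_upwards [eventually_gt_atTop 0] with n hn
  have hn' : (0 : ℝ) < n := by exact_mod_cast hn
  rw [Real.norm_eq_abs, show u n / n - r = (u n - r * n) / n by field_simp, abs_div,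
    abs_of_pos hn']
  gcongr
  exact h n

lemma tendsto_comp_div {f : ℕ → ℝ} {p r : ℝ} {u : ℕ → ℕ} (hr : 0 < r)
    (hf : Tendsto (fun n : ℕ => f n / n) atTop (𝓝 p))
    (hu : Tendsto (fun n : ℕ => (u n : ℝ) / n) atTop (𝓝 r)) :
    Tendsto (fun n : ℕ => f (u n) / n) atTop (𝓝 (p * r)) := by
  have hu' : Tendsto u atTop atTop := by
    rw [← tendsto_natCast_atTop_iff (R := ℝ)]
    refine (hu.pos_mul_atTop hr tendsto_natCast_atTop_atTop).congr' ?_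
    filter_upwards [eventually_gt_atTop 0] with n hn
    have hn' : (n : ℝ) ≠ 0 := by exact_mod_cast hn.ne'
    field_simp
  refine ((hf.comp hu').mul hu).congr' ?_
  filter_upwards [hu'.eventually_gt_atTop 0] with n hn
  have hn' : (u n : ℝ) ≠ 0 := by exact_mod_cast hn.ne'
  simp only [Function.comp]
  field_simp

variable {𝒳 : Type*}

lemma tendsto_cnt_div {ω : Path 𝒳} {m : ℕ} {s : ℕ → 𝒳} {p : ℝ}
    (h : Tendsto (fun n : ℕ => (cnt ω m s 0 ((n : ℤ) - 1) : ℝ) / n) atTop (𝓝 p)) {u v : ℕ → ℕ}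
    (huv : ∀ᶠ n in atTop, u n ≤ v n)
    (hu : Tendsto (fun n : ℕ => (u n : ℝ) / n) atTop (𝓝 (1 / 2)))
    (hv : Tendsto (fun n : ℕ => (v n : ℝ) / n) atTop (𝓝 1)) :
    Tendsto (fun n : ℕ => (cnt ω m s (u n) ((v n : ℤ) - 1) : ℝ) / n) atTop (𝓝 (p / 2)) := by
  have h1 := tendsto_comp_div one_half_pos h hu
  have h2 := tendsto_comp_div one_pos h hv
  rw [show p / 2 = p * 1 - p * (1 / 2) by ring]
  refine (h2.sub h1).congr' ?_
  filter_upwards [huv] with n hn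
  obtain ⟨L, hL⟩ := Nat.exists_eq_add_of_le hn
  have := cnt_add ω m s 0 (u n) L
  rw [← hL, zero_add, zero_add,
    show (u n : ℤ) + L = v n by rw [hL]; push_cast; ring] at this
  rw [this]
  push_cast
  ring

lemma abs_half_add_sub_le (m n : ℕ) : |((half n + m : ℕ) : ℝ) - 1 / 2 * n| ≤ m + 1 := by
  have h1 : (n : ℝ) ≤ 2 * half n := by exact_mod_cast (by unfold half; omega : n ≤ 2 * half n)
  have h2 : (2 * half n : ℝ) ≤ n + 1 := by
    exact_mod_cast (by unfold half; omega : 2 * half n ≤ n + 1)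
  have h3 : (0 : ℝ) ≤ m := m.cast_nonneg
  rw [abs_le]
  push_cast
  constructor <;> linarith

lemma tendsto_half_add_div (m : ℕ) :
    Tendsto (fun n : ℕ => ((half n + m : ℕ) : ℝ) / n) atTop (𝓝 (1 / 2)) :=
  tendsto_div_of_abs_sub_le (abs_half_add_sub_le m)

lemma eventually_half_add_le (m : ℕ) : ∀ᶠ n in atTop, half n + m ≤ n := by
  filter_upwards [eventually_ge_atTop (2 * m + 2)] with n hn
  unfold half
  omega

lemma tendsto_cnt_tail_div {ω : Path 𝒳} {m m' : ℕ} {s : ℕ → 𝒳} {p : ℝ}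
    (h : Tendsto (fun n : ℕ => (cnt ω m s 0 ((n : ℤ) - 1) : ℝ) / n) atTop (𝓝 p)) :
    Tendsto (fun n : ℕ => (cnt ω m s ((half n : ℤ) + m') n : ℝ) / n) atTop (𝓝 (p / 2)) := by
  have := tendsto_cnt_div h (u := fun n => half n + m') (v := fun n => n + 1)
    ((eventually_half_add_le m').mono fun n hn => by omega) (tendsto_half_add_div m')
    (tendsto_div_of_abs_sub_le (C := 1) fun n => by simp)
  simpa using this

lemma tendsto_cnt_tail_pred_div {ω : Path 𝒳} {m m' : ℕ} {s : ℕ → 𝒳} {p : ℝ}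
    (h : Tendsto (fun n : ℕ => (cnt ω m s 0 ((n : ℤ) - 1) : ℝ) / n) atTop (𝓝 p)) :
    Tendsto (fun n : ℕ => (cnt ω m s ((half n : ℤ) + m' - 1) ((n : ℤ) - 1) : ℝ) / n) atTop
      (𝓝 (p / 2)) := by
  have := tendsto_cnt_div h (u := fun n => half n + m' - 1) (v := fun n => n)
    ((eventually_half_add_le m').mono fun n hn => by omega)
    (tendsto_div_of_abs_sub_le (C := m' + 2) fun n => by
      have h1 := abs_le.1 (abs_half_add_sub_le m' n)
      have h2 : (half n + m' : ℕ) ≤ ((half n + m' - 1 : ℕ) : ℝ) + 1 := by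
        exact_mod_cast (by omega : half n + m' ≤ half n + m' - 1 + 1)
      have h3 : ((half n + m' - 1 : ℕ) : ℝ) ≤ (half n + m' : ℕ) := by
        exact_mod_cast Nat.sub_le _ _
      rw [abs_le]
      constructor <;> linarith)
    (tendsto_div_of_abs_sub_le (C := 0) fun n => by simp)
  refine this.congr' ?_
  filter_upwards [eventually_gt_atTop 0] with n hn
  have : 0 < half n := by unfold half; omega
  rw [Nat.cast_sub (by omega)]
  push_cast
  rfl

variable [MeasurableSpace 𝒳]

/-- The limiting relative frequency of every finite string is its probability. -/
def HasFrequencies (μ : Measure (Path 𝒳)) (ω : Path 𝒳) : Prop :=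
  ∀ (m : ℕ) (s : ℕ → 𝒳),
    Tendsto (fun n : ℕ => (cnt ω m s 0 ((n : ℤ) - 1) : ℝ) / n) atTop (𝓝 (pstr μ m s))

lemma ae_hasFrequencies [Countable 𝒳] [MeasurableSingletonClass 𝒳] {μ : Measure (Path 𝒳)}
    [IsProbabilityMeasure μ] (hErg : Ergodic (shift : Path 𝒳 → Path 𝒳) μ) :
    ∀ᵐ ω ∂μ, HasFrequencies μ ω := by
  obtain ⟨ω₀⟩ : Nonempty (Path 𝒳) := nonempty_of_isProbabilityMeasure μ
  have key : ∀ᵐ ω ∂μ, ∀ (m : ℕ) (σ : Fin m → 𝒳),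
      Tendsto (fun n : ℕ => (cnt ω m (extendStr (ω₀ 0) σ) 0 ((n : ℤ) - 1) : ℝ) / n) atTop
        (𝓝 (pstr μ m (extendStr (ω₀ 0) σ))) := by
    rw [ae_all_iff]
    intro m
    rw [ae_all_iff]
    intro σ
    set s := extendStr (ω₀ 0) σ
    have hA := measurableSet_occursAt m s 0
    set A : Set (Path 𝒳) := {ω | OccursAt ω m s 0} with hAdef
    have h := tendsto_birkhoffSum_div (g := A.indicator 1) hErg
      (measurable_one.indicator hA) (C := 1) (fun ω => by
        by_cases h : ω ∈ A <;> simp [h])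
    filter_upwards [h] with ω hω
    rw [integral_indicator_one hA, ← pstr_eq] at hω
    refine hω.congr fun n => ?_
    congr 1
    have := cnt_eq_sum ω m s 0 n
    rw [zero_add] at this
    rw [this, birkhoffSum]
    push_cast
    refine Finset.sum_congr rfl fun j _ => ?_
    have e : shift^[j] ω ∈ A ↔ OccursAt ω m s (0 + j) := occursAt_shift_iterate
    by_cases h' : OccursAt ω m s (0 + j)
    · simp [indicator, e.2 h', if_pos h']
    · simp [indicator, mt e.1 h', if_neg h']
  filter_upwards [key] with ω hω m s
  have h := hω m fun i => s i
  rw [pstr_congr μ fun j hj => extendStr_restrict (ω₀ 0) m s hj] at h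
  exact h.congr fun n => by rw [cnt_congr fun j hj => extendStr_restrict (ω₀ 0) m s hj]

variable {μ : Measure (Path 𝒳)}

/-- Every string of positive probability eventually belongs to `ℒ`. -/
lemma HasFrequencies.eventually_inL {ω : Path 𝒳} (h : HasFrequencies μ ω) {γ : ℝ} (hγ : 0 < γ)
    {m : ℕ} {s : ℕ → 𝒳} (hs : 0 < pstr μ (m + 1) s) : ∀ᶠ n in atTop, inL γ ω n m s := by
  have h1 := tendsto_cnt_tail_div (m' := m) (h (m + 1) s)
  have hlt : ∀ᶠ n in atTop, inL2 γ ω n m s := by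
    have h0 : Tendsto (fun n : ℕ => (n : ℝ) ^ (-γ)) atTop (𝓝 0) :=
      (tendsto_rpow_neg_atTop hγ).comp tendsto_natCast_atTop_atTop
    filter_upwards [h0.eventually_lt h1 (by positivity), eventually_gt_atTop 0] with n hn hn0
    have hn' : (0 : ℝ) < n := by exact_mod_cast hn0
    rw [lt_div_iff₀ hn'] at hn
    rwa [inL2, sub_eq_neg_add, Real.rpow_add_one hn'.ne']
  obtain ⟨n₀, hn₀⟩ := hlt.exists
  have hpos : 0 < cnt ω (m + 1) s ((half n₀ : ℤ) + m) n₀ := by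
    have : (0 : ℝ) < cnt ω (m + 1) s ((half n₀ : ℤ) + m) n₀ :=
      (Real.rpow_nonneg n₀.cast_nonneg _).trans_lt hn₀
    exact_mod_cast this
  classical
  obtain ⟨t, ht⟩ := Finset.card_pos.1 hpos
  simp only [Finset.mem_filter, Finset.mem_Icc] at ht
  filter_upwards [hlt, eventually_ge_atTop (2 * t.toNat + 2)] with n h2 hn
  refine ⟨⟨t, by omega, ?_, ht.2⟩, h2⟩
  unfold half
  omega

variable [MeasurableSingletonClass 𝒳]

lemma HasFrequencies.tendsto_empCond {ω : Path 𝒳} (h : HasFrequencies μ ω)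
    (hμ : MeasurePreserving (shift : Path 𝒳 → Path 𝒳) μ μ) {m : ℕ} (x : 𝒳) {s : ℕ → 𝒳}
    (hs : 0 < pstr μ m s) :
    Tendsto (fun n => empCond ω n m x s) atTop (𝓝 (pcond μ m x s)) := by
  have h1 := tendsto_cnt_tail_div (m' := m) (h (m + 1) (withLast x s))
  have h2 := tendsto_cnt_tail_pred_div (m' := m) (h m s)
  rw [pcond_eq hμ, ← div_div_div_cancel_right₀ (two_ne_zero' ℝ)]
  refine (h1.div h2 (by positivity)).congr' ?_
  filter_upwards [eventually_gt_atTop 0] with n hn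
  have hn' : (n : ℝ) ≠ 0 := by exact_mod_cast hn.ne'
  exact div_div_div_cancel_right₀ hn' _ _

end Frequencies

section Deviation

lemma exp_mean_le {q θ : ℝ} (hq0 : 0 ≤ q) (hq1 : q ≤ 1) (hθ : |θ| ≤ 1) :
    q * Real.exp (θ * (1 - q)) + (1 - q) * Real.exp (θ * (0 - q)) ≤ Real.exp (θ ^ 2) := by
  have bound : ∀ u : ℝ, |u| ≤ 1 → Real.exp (θ * u) ≤ 1 + θ * u + θ ^ 2 := by
    intro u hu
    have hle : |θ * u| ≤ 1 := by
      rw [abs_mul]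
      exact mul_le_one₀ hθ (abs_nonneg _) hu
    have h1 := (abs_le.1 (Real.abs_exp_sub_one_sub_id_le hle)).2
    have h2 : (θ * u) ^ 2 ≤ θ ^ 2 := by
      rw [mul_pow]
      have : u ^ 2 ≤ 1 := (sq_le_one_iff_abs_le_one u).2 hu
      nlinarith [sq_nonneg θ]
    linarith
  have h1 := bound (1 - q) (by rw [abs_le]; constructor <;> linarith)
  have h2 := bound (0 - q) (by rw [abs_le]; constructor <;> linarith)
  have h3 := Real.add_one_le_exp (θ ^ 2)
  calc _ ≤ q * (1 + θ * (1 - q) + θ ^ 2) + (1 - q) * (1 + θ * (0 - q) + θ ^ 2) := by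
        gcongr
    _ = θ ^ 2 + 1 := by ring
    _ ≤ _ := h3

variable {𝒳 : Type*}

/-- `G` depends only on the coordinates `0, …, t`. -/
def DependsUpTo {E : Type*} (G : Path 𝒳 → E) (t : ℕ) : Prop :=
  ∀ ω ω' : Path 𝒳, (∀ i : ℤ, 0 ≤ i → i ≤ t → ω i = ω' i) → G ω = G ω'

lemma occursAt_congr_path {ω ω' : Path 𝒳} {m : ℕ} {s : ℕ → 𝒳} {t : ℤ}
    (h : ∀ j : ℕ, j < m → ω (t - j) = ω' (t - j)) : OccursAt ω m s t ↔ OccursAt ω' m s t := by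
  unfold OccursAt
  exact forall₂_congr fun j hj => by rw [h j hj]

open Classical in
/-- The exponent of the compensated exponential process attached to the occurrences of the string
`s` of length `m` at time `t` and the event that it is followed by `x`. -/
def expoTerm (θ q : ℝ) (m : ℕ) (s : ℕ → 𝒳) (x : 𝒳) (t : ℤ) (ω : Path 𝒳) : ℝ :=
  if OccursAt ω m s t then θ * ((if ω (t + 1) = x then 1 else 0) - q) - θ ^ 2 else 0

lemma expoTerm_dependsUpTo (θ q : ℝ) {m t : ℕ} (hm : m ≤ t + 1) (s : ℕ → 𝒳) (x : 𝒳) :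
    DependsUpTo (expoTerm θ q m s x t) (t + 1) := by
  intro ω ω' h
  have h1 : OccursAt ω m s t ↔ OccursAt ω' m s t :=
    occursAt_congr_path fun j hj => h _ (by omega) (by push_cast; omega)
  have h2 : ω (t + 1) = ω' (t + 1) := h _ (by omega) (by push_cast; omega)
  unfold expoTerm
  rw [propext h1, h2]

lemma DependsUpTo.mono {E : Type*} {G : Path 𝒳 → E} {t t' : ℕ} (h : DependsUpTo G t)
    (ht : t ≤ t') : DependsUpTo G t' := fun ω ω' H => h ω ω' fun i h0 h1 => H i h0 (by omega)

variable [MeasurableSpace 𝒳] [Countable 𝒳] [MeasurableSingletonClass 𝒳]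

lemma DependsUpTo.measurable {E : Type*} [MeasurableSpace E] {G : Path 𝒳 → E} {t : ℕ}
    (h : DependsUpTo G t) : Measurable G := by
  rcases isEmpty_or_nonempty (Path 𝒳) with hemp | ⟨⟨ω₀⟩⟩
  · exact measurable_of_empty _
  let r : Path 𝒳 → (Fin (t + 1) → 𝒳) := fun ω j => ω (j : ℕ)
  let e : (Fin (t + 1) → 𝒳) → Path 𝒳 := fun w i => extendStr (ω₀ 0) w i.toNat
  have hr : Measurable r := measurable_pi_lambda _ fun j => measurable_pi_apply _
  have hG : G = (G ∘ e) ∘ r := by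
    funext ω
    refine h _ _ fun i h0 h1 => ?_
    have : i.toNat < t + 1 := by omega
    simp only [e, r, extendStr, this, dif_pos]
    congr 1
    omega
  rw [hG]
  exact (measurable_of_countable _).comp hr

/-- To compare integrals, it suffices to compare them on the cylinders of words occupying the
positions `0, …, t`. -/
lemma lintegral_le_of_cylinders {μ : Measure (Path 𝒳)} {F G : Path 𝒳 → ℝ≥0∞} (t : ℕ)
    (h : ∀ w : ℕ → 𝒳, ∫⁻ ω in {ω | OccursAt ω (t + 1) w t}, F ω ∂μ ≤
      ∫⁻ ω in {ω | OccursAt ω (t + 1) w t}, G ω ∂μ) : ∫⁻ ω, F ω ∂μ ≤ ∫⁻ ω, G ω ∂μ := by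
  rcases isEmpty_or_nonempty (Path 𝒳) with hemp | ⟨⟨ω₀⟩⟩
  · simp [μ.eq_zero_of_isEmpty]
  set S : (Fin (t + 1) → 𝒳) → Set (Path 𝒳) :=
    fun σ => {ω | OccursAt ω (t + 1) (extendStr (ω₀ 0) σ) t} with hS
  have hU : (⋃ σ, S σ) = univ := by
    refine eq_univ_of_forall fun ω => mem_iUnion.2 ⟨fun j => ω (t - (j : ℕ)), fun j hj => ?_⟩
    exact (extendStr_restrict (ω₀ 0) (t + 1) (fun j => ω (t - (j : ℕ))) hj).symm
  have hd : Pairwise (Function.onFun Disjoint S) := by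
    intro σ σ' hne
    refine Set.disjoint_left.2 fun ω h1 h2 => hne ?_
    funext j
    have := (h1 j j.2).symm.trans (h2 j j.2)
    simpa only [extendStr, j.2, dif_pos] using this
  have hm : ∀ σ, MeasurableSet (S σ) := fun σ => measurableSet_occursAt _ _ _
  rw [← setLIntegral_univ F, ← setLIntegral_univ G, ← hU, lintegral_iUnion hm hd,
    lintegral_iUnion hm hd]
  exact ENNReal.tsum_le_tsum fun σ => h _

variable {μ : Measure (Path 𝒳)} [IsProbabilityMeasure μ]

lemma setLIntegral_exp_expoTerm_le (hμ : MeasurePreserving (shift : Path 𝒳 → Path 𝒳) μ μ)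
    {K m t : ℕ} {s w : ℕ → 𝒳} (hs : IsMemoryBound μ s K) (hKm : K ≤ m) (hmt : m ≤ t + 1)
    (hKt : K ≤ t) (x : 𝒳) {θ : ℝ} (hθ : |θ| ≤ 1) :
    ∫⁻ ω in {ω | OccursAt ω (t + 1) w t},
        ENNReal.ofReal (Real.exp (expoTerm θ (pcond μ K x s) m s x t ω)) ∂μ ≤
      μ {ω | OccursAt ω (t + 1) w t} := by
  set q := pcond μ K x s with hq
  obtain ⟨hq0, hq1⟩ := pcond_mem_Icc hμ K x s
  set S : Set (Path 𝒳) := {ω | OccursAt ω (t + 1) w t} with hS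
  have hSm : MeasurableSet S := measurableSet_occursAt _ _ _
  by_cases hw : ∀ j < m, w j = s j
  · set B : Set (Path 𝒳) := {ω | OccursAt ω (t + 1 + 1) (withLast x w) (t + 1 : ℕ)} with hB
    have hBm : MeasurableSet B := measurableSet_occursAt _ _ _
    have hBmem : ∀ ω, ω ∈ B ↔ ω (t + 1) = x ∧ ω ∈ S := fun ω => by
      simp only [hB, hS, mem_ofPred_eq, Nat.cast_add t 1, Nat.cast_one, occursAt_withLast]
    have hBS : B ⊆ S := fun ω h => ((hBmem ω).1 h).2
    have hμB : μ.real B = q * μ.real S := by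
      rw [hB, hS, measureReal_occursAt hμ, measureReal_occursAt hμ, hq,
        ← pcond_congr hμ x fun j hj => hw j (hj.trans_le hKm)]
      exact (hs.congr hμ fun j hj => (hw j (hj.trans_le hKm)).symm).pstr_withLast hμ
        (by omega) x
    have hocc : ∀ ω ∈ S, OccursAt ω m s t := fun ω hω =>
      (occursAt_congr hw t).1 (OccursAt.mono hω hmt)
    rw [← lintegral_inter_add_sdiff _ S hBm, inter_eq_right.2 hBS]
    have e1 : ∫⁻ ω in B, ENNReal.ofReal (Real.exp (expoTerm θ q m s x t ω)) ∂μ =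
        ENNReal.ofReal (Real.exp (θ * (1 - q) - θ ^ 2)) * μ B := by
      rw [← setLIntegral_const]
      refine setLIntegral_congr_fun hBm fun ω hω => ?_
      simp only [expoTerm, hocc ω (hBS hω), ((hBmem ω).1 hω).1, if_true]
    have e2 : ∫⁻ ω in S \ B, ENNReal.ofReal (Real.exp (expoTerm θ q m s x t ω)) ∂μ =
        ENNReal.ofReal (Real.exp (θ * (0 - q) - θ ^ 2)) * μ (S \ B) := by
      rw [← setLIntegral_const]
      refine setLIntegral_congr_fun (hSm.diff hBm) fun ω hω => ?_
      have : ω (t + 1) ≠ x := fun h => hω.2 ((hBmem ω).2 ⟨h, hω.1⟩)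
      simp only [expoTerm, hocc ω hω.1, this, if_true, if_false]
    have hdiff : μ.real (S \ B) = (1 - q) * μ.real S := by
      rw [measureReal_sdiff hBS hBm, hμB]
      ring
    rw [e1, e2, ← ofReal_measureReal (s := B), ← ofReal_measureReal (s := S \ B),
      ← ofReal_measureReal (s := S), hμB, hdiff,
      ← ENNReal.ofReal_mul (Real.exp_nonneg _), ← ENNReal.ofReal_mul (Real.exp_nonneg _),
      ← ENNReal.ofReal_add (by positivity)
        (mul_nonneg (Real.exp_nonneg _) (mul_nonneg (by linarith) measureReal_nonneg))]
    refine ENNReal.ofReal_le_ofReal ?_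
    have h := exp_mean_le hq0 hq1 hθ
    rw [Real.exp_sub, Real.exp_sub]
    calc _ = (q * Real.exp (θ * (1 - q)) + (1 - q) * Real.exp (θ * (0 - q))) /
          Real.exp (θ ^ 2) * μ.real S := by ring
      _ ≤ 1 * μ.real S := by
          gcongr
          exact (div_le_one (Real.exp_pos _)).2 h
      _ = _ := one_mul _
  · have : ∀ ω ∈ S, ¬ OccursAt ω m s t := fun ω hω h => hw fun j hj =>
      ((hω j (by omega)).symm.trans (h j hj))
    rw [setLIntegral_congr_fun (g := fun _ => 1) hSm fun ω hω => by simp [expoTerm, this ω hω]]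
    simp

lemma lintegral_mul_exp_expoTerm_le (hμ : MeasurePreserving (shift : Path 𝒳 → Path 𝒳) μ μ)
    {K m t : ℕ} {s : ℕ → 𝒳} (hs : IsMemoryBound μ s K) (hKm : K ≤ m) (hmt : m ≤ t + 1)
    (hKt : K ≤ t) (x : 𝒳) {θ : ℝ} (hθ : |θ| ≤ 1) {G : Path 𝒳 → ℝ≥0∞} (hG : DependsUpTo G t) :
    ∫⁻ ω, G ω * ENNReal.ofReal (Real.exp (expoTerm θ (pcond μ K x s) m s x t ω)) ∂μ ≤
      ∫⁻ ω, G ω ∂μ := by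
  refine lintegral_le_of_cylinders t fun w => ?_
  set S : Set (Path 𝒳) := {ω | OccursAt ω (t + 1) w t} with hS
  have hSm : MeasurableSet S := measurableSet_occursAt _ _ _
  rcases S.eq_empty_or_nonempty with h | ⟨ω₁, h₁⟩
  · simp [h]
  have hconst : ∀ ω ∈ S, G ω = G ω₁ := fun ω hω => hG _ _ fun i h0 h1 => by
    have e : i = t - ((t - i).toNat : ℤ) := by omega
    rw [e]
    exact (hω _ (by omega)).trans (h₁ _ (by omega)).symm
  have hmeas : Measurable fun ω =>
      ENNReal.ofReal (Real.exp (expoTerm θ (pcond μ K x s) m s x t ω)) :=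
    (Real.measurable_exp.comp (expoTerm_dependsUpTo θ _ hmt s x).measurable).ennreal_ofReal
  rw [setLIntegral_congr_fun (g := fun ω => G ω₁ *
      ENNReal.ofReal (Real.exp (expoTerm θ (pcond μ K x s) m s x t ω))) hSm fun ω hω => by
        simp only [hconst ω hω],
    setLIntegral_congr_fun (f := G) (g := fun _ => G ω₁) hSm hconst,
    lintegral_const_mul _ hmeas, setLIntegral_const]
  gcongr
  exact setLIntegral_exp_expoTerm_le hμ hs hKm hmt hKt x hθ

/-- The compensated exponential process is a supermartingale. -/
lemma lintegral_indicator_mul_exp_sum_le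
    (hμ : MeasurePreserving (shift : Path 𝒳 → Path 𝒳) μ μ)
    {K m a : ℕ} {s : ℕ → 𝒳} (hs : IsMemoryBound μ s K) (hKm : K ≤ m) (hma : m ≤ a + 1)
    (hKa : K ≤ a) (x : 𝒳) {θ : ℝ} (hθ : |θ| ≤ 1) {A : Set (Path 𝒳)}
    (hA : DependsUpTo (fun ω => ω ∈ A) a) (L : ℕ) :
    ∫⁻ ω in A, ENNReal.ofReal (Real.exp (∑ j ∈ Finset.range L,
      expoTerm θ (pcond μ K x s) m s x (a + j : ℕ) ω)) ∂μ ≤ μ A := by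
  have hAm : MeasurableSet A := measurableSet_setOfPred.2 hA.measurable
  set q := pcond μ K x s with hq
  set W : ℕ → Path 𝒳 → ℝ≥0∞ := fun L => A.indicator fun ω => ENNReal.ofReal (Real.exp
    (∑ j ∈ Finset.range L, expoTerm θ q m s x (a + j : ℕ) ω)) with hW
  have hWd : ∀ L, DependsUpTo (W L) (a + L) := by
    intro L ω ω' h
    have h1 : ω ∈ A ↔ ω' ∈ A := (hA.mono (Nat.le_add_right a L) ω ω' h).to_iff
    have h2 : ∀ j ∈ Finset.range L, expoTerm θ q m s x (a + j : ℕ) ω =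
        expoTerm θ q m s x (a + j : ℕ) ω' := fun j hj =>
      ((expoTerm_dependsUpTo θ q (by omega) s x).mono
        (by have := Finset.mem_range.1 hj; omega)) ω ω' h
    by_cases hω : ω ∈ A
    · simp only [hW, indicator_of_mem hω, indicator_of_mem (h1.1 hω), Finset.sum_congr rfl h2]
    · simp only [hW, indicator_of_notMem hω, indicator_of_notMem (mt h1.2 hω)]
  have key : ∀ L, ∫⁻ ω, W L ω ∂μ ≤ μ A := by
    intro L
    induction L with
    | zero => simp [hW, lintegral_indicator hAm]
    | succ L ih =>
      refine le_trans (le_of_eq ?_) ((lintegral_mul_exp_expoTerm_le hμ hs hKm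
        (t := a + L) (by omega) (by omega) x hθ (hWd L)).trans ih)
      refine lintegral_congr fun ω => ?_
      by_cases h : ω ∈ A
      · simp only [hW, indicator, h, if_true, Finset.sum_range_succ, Real.exp_add]
        rw [ENNReal.ofReal_mul (Real.exp_nonneg _)]
      · simp [hW, h]
  rw [← lintegral_indicator hAm]
  exact key L

end Deviation

section BadEvents

variable {𝒳 : Type*}

lemma sum_expoTerm (θ q : ℝ) (m a L : ℕ) (s : ℕ → 𝒳) (x : 𝒳) (ω : Path 𝒳) :
    ∑ j ∈ Finset.range L, expoTerm θ q m s x (a + j : ℕ) ω =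
      θ * (cnt ω (m + 1) (withLast x s) (a + 1) (a + 1 + L - 1) -
        q * cnt ω m s a (a + L - 1)) - θ ^ 2 * cnt ω m s a (a + L - 1) := by
  classical
  rw [cnt_eq_sum, cnt_eq_sum]
  push_cast
  rw [mul_sub, Finset.mul_sum, Finset.mul_sum, Finset.mul_sum, Finset.mul_sum,
    ← Finset.sum_sub_distrib, ← Finset.sum_sub_distrib]
  refine Finset.sum_congr rfl fun j _ => ?_
  have e : OccursAt ω (m + 1) (withLast x s) ((a : ℤ) + 1 + j) ↔
      ω (a + j + 1) = x ∧ OccursAt ω m s (a + j) := by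
    rw [add_right_comm, occursAt_withLast]
  unfold expoTerm
  by_cases h : OccursAt ω m s ((a : ℤ) + j) <;> by_cases h' : ω ((a : ℤ) + j + 1) = x
  · rw [if_pos h, if_pos h', if_pos (e.2 ⟨h', h⟩), if_pos h]
    ring
  · rw [if_pos h, if_neg h', if_neg (mt e.1 fun H => h' H.1), if_pos h]
    ring
  all_goals
    rw [if_neg h, if_neg (mt e.1 fun H => h H.2), if_neg h]
    ring

lemma empCond_congr {ω : Path 𝒳} {m : ℕ} {s s' : ℕ → 𝒳} (h : ∀ j < m, s j = s' j) (n : ℕ)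
    (x : 𝒳) : empCond ω n m x s = empCond ω n m x s' := by
  unfold empCond
  rw [cnt_congr h, cnt_congr (withLast_congr h x)]

lemma inL2_congr {γ : ℝ} {ω : Path 𝒳} {n m : ℕ} {s s' : ℕ → 𝒳} (h : ∀ j < m + 1, s j = s' j) :
    inL2 γ ω n m s ↔ inL2 γ ω n m s' := by
  unfold inL2
  rw [cnt_congr h]

variable [MeasurableSpace 𝒳] [Countable 𝒳] [MeasurableSingletonClass 𝒳]
  {μ : Measure (Path 𝒳)} [IsProbabilityMeasure μ]

lemma measure_inter_le_sum_expoTerm (hμ : MeasurePreserving (shift : Path 𝒳 → Path 𝒳) μ μ)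
    {K m a : ℕ} {s : ℕ → 𝒳} (hs : IsMemoryBound μ s K) (hKm : K ≤ m) (hma : m ≤ a + 1)
    (hKa : K ≤ a) (x : 𝒳) {θ : ℝ} (hθ : |θ| ≤ 1) {A : Set (Path 𝒳)}
    (hA : DependsUpTo (fun ω => ω ∈ A) a) (L : ℕ) (c : ℝ) :
    μ (A ∩ {ω | c ≤ ∑ j ∈ Finset.range L, expoTerm θ (pcond μ K x s) m s x (a + j : ℕ) ω}) ≤
      ENNReal.ofReal (Real.exp (-c)) * μ A := by
  set W : Path 𝒳 → ℝ := fun ω =>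
    ∑ j ∈ Finset.range L, expoTerm θ (pcond μ K x s) m s x (a + j : ℕ) ω with hW
  have hWm : Measurable W := by
    refine Finset.measurable_sum _ fun j _ => ?_
    exact (expoTerm_dependsUpTo θ _ (by omega) s x).measurable
  have h1 := lintegral_indicator_mul_exp_sum_le hμ hs hKm hma hKa x hθ hA L
  have h2 := mul_meas_ge_le_lintegral (μ := μ.restrict A)
    (f := fun ω => ENNReal.ofReal (Real.exp (W ω))) (Real.measurable_exp.comp hWm).ennreal_ofReal
    (ENNReal.ofReal (Real.exp c))
  have h3 : μ (A ∩ {ω | c ≤ W ω}) ≤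
      μ.restrict A {ω | ENNReal.ofReal (Real.exp c) ≤ ENNReal.ofReal (Real.exp (W ω))} := by
    refine le_trans ?_ (Measure.le_restrict_apply _ _)
    refine measure_mono fun ω hω => ⟨?_, hω.1⟩
    exact ENNReal.ofReal_le_ofReal (Real.exp_le_exp.2 hω.2)
  calc μ (A ∩ {ω | c ≤ W ω})
      = ENNReal.ofReal (Real.exp (-c)) *
          (ENNReal.ofReal (Real.exp c) * μ (A ∩ {ω | c ≤ W ω})) := by
        rw [← mul_assoc, ← ENNReal.ofReal_mul (Real.exp_nonneg _), ← Real.exp_add]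
        simp
    _ ≤ ENNReal.ofReal (Real.exp (-c)) * μ A := by
        gcongr
        exact (mul_le_mul_right h3 _).trans (h2.trans h1)

lemma measure_deviation_le (hμ : MeasurePreserving (shift : Path 𝒳 → Path 𝒳) μ μ)
    {K m a : ℕ} {s : ℕ → 𝒳} (hs : IsMemoryBound μ s K) (hKm : K ≤ m) (hma : m ≤ a + 1)
    (hKa : K ≤ a) (x : 𝒳) {ε R : ℝ} (hε0 : 0 ≤ ε) (hε : ε ≤ 2) (hR : 0 ≤ R) {A : Set (Path 𝒳)}
    (hA : DependsUpTo (fun ω => ω ∈ A) a) (L : ℕ) :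
    μ (A ∩ {ω | R < cnt ω m s a (a + L - 1) ∧
        ε < |(cnt ω (m + 1) (withLast x s) (a + 1) (a + 1 + L - 1) : ℝ) /
          cnt ω m s a (a + L - 1) - pcond μ K x s|}) ≤
      2 * ENNReal.ofReal (Real.exp (-(ε ^ 2 / 4 * R))) * μ A := by
  have hθ : |ε / 2| ≤ 1 := by rw [abs_of_nonneg (by positivity)]; linarith
  have hθ' : |-(ε / 2)| ≤ 1 := by rwa [abs_neg]
  have h1 := measure_inter_le_sum_expoTerm hμ hs hKm hma hKa x hθ hA L (ε ^ 2 / 4 * R)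
  have h2 := measure_inter_le_sum_expoTerm hμ hs hKm hma hKa x hθ' hA L (ε ^ 2 / 4 * R)
  rw [two_mul, add_mul]
  refine le_trans (measure_mono ?_) ((measure_union_le _ _).trans (add_le_add h1 h2))
  rintro ω ⟨hωA, hN, hdev⟩
  have hN0 : (0 : ℝ) < cnt ω m s a (a + L - 1) := hR.trans_lt hN
  have hmul : ε ^ 2 / 4 * R ≤ ε ^ 2 / 4 * cnt ω m s a (a + L - 1) := by gcongr
  rcases lt_abs.1 hdev with h | h
  · refine Or.inl ⟨hωA, ?_⟩
    rw [lt_sub_iff_add_lt, lt_div_iff₀ hN0] at h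
    rw [mem_ofPred_eq, sum_expoTerm]
    nlinarith
  · refine Or.inr ⟨hωA, ?_⟩
    rw [neg_sub, lt_sub_iff_add_lt, ← lt_sub_iff_add_lt', div_lt_iff₀ hN0] at h
    rw [mem_ofPred_eq, sum_expoTerm]
    nlinarith

/-- Some string with memory bound `K` that ends at time `t` of the first half of the data and is
frequent in the second half has an untypical empirical conditional frequency. -/
def badEvent (μ : Measure (Path 𝒳)) (β γ : ℝ) (K n m t : ℕ) : Set (Path 𝒳) :=
  {ω | K ≤ m ∧ m ≤ t ∧ t < half n ∧ ∃ (b : ℕ → 𝒳) (x : 𝒳),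
    OccursAt ω (m + 1) (withLast x b) t ∧ IsMemoryBound μ b K ∧
    inL2 γ ω n m (withLast x b) ∧
    (n : ℝ) ^ (-β) / 2 < |empCond ω n m x b - pcond μ K x b|}

lemma measure_badEvent_string_le (hμ : MeasurePreserving (shift : Path 𝒳 → Path 𝒳) μ μ)
    {β γ : ℝ} (hβ : 0 < β) {K n m t : ℕ} (hn : 0 < n) (hKm : K ≤ m) (ht : t < half n)
    (hmt : m ≤ t) {b : ℕ → 𝒳} (hb : IsMemoryBound μ b K) (x : 𝒳) :
    μ ({ω | OccursAt ω (m + 1) (withLast x b) t} ∩ {ω | inL2 γ ω n m (withLast x b) ∧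
        (n : ℝ) ^ (-β) / 2 < |empCond ω n m x b - pcond μ K x b|}) ≤
      2 * ENNReal.ofReal (Real.exp (-(1 / 16) * ((n : ℝ) ^ (1 - γ - 2 * β)))) *
        μ {ω | OccursAt ω (m + 1) (withLast x b) t} := by
  have hn' : (0 : ℝ) < n := by exact_mod_cast hn
  rcases le_or_gt (half n + m) n with hle | hgt
  · obtain ⟨L, hL⟩ := Nat.exists_eq_add_of_le (show half n + m - 1 ≤ n by omega)
    set a := half n + m - 1 with ha
    have hε2 : (n : ℝ) ^ (-β) / 2 ≤ 2 := by
      have : (n : ℝ) ^ (-β) ≤ 1 :=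
        Real.rpow_le_one_of_one_le_of_nonpos (by exact_mod_cast hn) (by linarith)
      linarith
    have hA : DependsUpTo (fun ω => ω ∈ {ω : Path 𝒳 | OccursAt ω (m + 1) (withLast x b) t}) a := by
      intro ω ω' h
      exact propext (occursAt_congr_path fun j hj => h _ (by omega) (by omega))
    have h := measure_deviation_le hμ hb hKm (a := a) (by omega) (by omega) x
      (ε := (n : ℝ) ^ (-β) / 2) (R := (n : ℝ) ^ (1 - γ)) (by positivity) hε2 (by positivity) hA L
    have e : ((n : ℝ) ^ (-β) / 2) ^ 2 / 4 * (n : ℝ) ^ (1 - γ) =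
        1 / 16 * (n : ℝ) ^ (1 - γ - 2 * β) := by
      rw [show 1 - γ - 2 * β = -β + -β + (1 - γ) by ring, Real.rpow_add hn', Real.rpow_add hn']
      ring
    rw [e, ← neg_mul] at h
    refine le_trans (measure_mono ?_) h
    rintro ω ⟨hω, h2, hdev⟩
    have hcnt := cnt_withLast_le ω m b x a L
    rw [show (a : ℤ) + 1 + L - 1 = n by omega, show (a : ℤ) + L - 1 = n - 1 by omega] at hcnt ⊢
    unfold inL2 at h2
    unfold empCond at hdev
    rw [show (half n : ℤ) + m = a + 1 by omega] at h2 hdev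
    rw [add_sub_cancel_right] at hdev
    exact ⟨hω, h2.trans_le (by exact_mod_cast hcnt), hdev⟩
  · have : {ω : Path 𝒳 | inL2 γ ω n m (withLast x b) ∧
        (n : ℝ) ^ (-β) / 2 < |empCond ω n m x b - pcond μ K x b|} = ∅ := by
      refine eq_empty_of_forall_notMem fun ω hω => ?_
      have h2 := hω.1
      unfold inL2 cnt at h2
      rw [Finset.Icc_eq_empty (by omega)] at h2
      simp only [Finset.filter_empty, Finset.card_empty, Nat.cast_zero] at h2
      exact absurd h2 (not_lt.2 (by positivity))
    rw [this]
    simp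

lemma measure_badEvent_le (hμ : MeasurePreserving (shift : Path 𝒳 → Path 𝒳) μ μ)
    {β γ : ℝ} (hβ : 0 < β) (K n m t : ℕ) :
    μ (badEvent μ β γ K n m t) ≤
      2 * ENNReal.ofReal (Real.exp (-(1 / 16) * ((n : ℝ) ^ (1 - γ - 2 * β)))) := by
  by_cases hc : K ≤ m ∧ m ≤ t ∧ t < half n
  swap
  · have : badEvent μ β γ K n m t = ∅ :=
      eq_empty_of_forall_notMem fun ω hω => hc ⟨hω.1, hω.2.1, hω.2.2.1⟩
    rw [this]
    simp
  obtain ⟨hKm, hmt, ht⟩ := hc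
  have hn : 0 < n := by
    unfold half at ht
    omega
  obtain ⟨ω₀⟩ : Nonempty (Path 𝒳) := nonempty_of_isProbabilityMeasure μ
  set c := 2 * ENNReal.ofReal (Real.exp (-(1 / 16) * ((n : ℝ) ^ (1 - γ - 2 * β)))) with hcdef
  let S : 𝒳 × (Fin m → 𝒳) → ℕ → 𝒳 := fun p => withLast p.1 (extendStr (ω₀ 0) p.2)
  let A : 𝒳 × (Fin m → 𝒳) → Set (Path 𝒳) := fun p => {ω | OccursAt ω (m + 1) (S p) t}
  let E : 𝒳 × (Fin m → 𝒳) → Set (Path 𝒳) := fun p =>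
    {ω | IsMemoryBound μ (extendStr (ω₀ 0) p.2) K ∧ inL2 γ ω n m (S p) ∧ (n : ℝ) ^ (-β) / 2 <
      |empCond ω n m p.1 (extendStr (ω₀ 0) p.2) - pcond μ K p.1 (extendStr (ω₀ 0) p.2)|}
  have hsub : badEvent μ β γ K n m t ⊆ ⋃ p, A p ∩ E p := by
    rintro ω ⟨-, -, -, b, x, hocc, hb, h2, hdev⟩
    have hcg : ∀ j < m, b j = extendStr (ω₀ 0) (fun i : Fin m => b i) j :=
      fun j hj => (extendStr_restrict _ m b hj).symm
    refine mem_iUnion.2 ⟨(x, fun i => b i), (occursAt_congr (withLast_congr hcg x) t).1 hocc,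
      hb.congr hμ fun j hj => hcg j (by omega), (inL2_congr (withLast_congr hcg x)).1 h2, ?_⟩
    rwa [← empCond_congr hcg, ← pcond_congr hμ x fun j hj => hcg j (by omega)]
  have hAE : ∀ p, μ (A p ∩ E p) ≤ c * μ (A p) := by
    intro p
    by_cases hb : IsMemoryBound μ (extendStr (ω₀ 0) p.2) K
    · refine le_trans (measure_mono ?_)
        (measure_badEvent_string_le (γ := γ) hμ hβ hn hKm ht hmt hb p.1)
      exact fun ω hω => ⟨hω.1, hω.2.2⟩
    · have : A p ∩ E p = ∅ := eq_empty_of_forall_notMem fun ω hω => hb hω.2.1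
      rw [this]
      simp
  have hd : Pairwise (Function.onFun Disjoint A) := by
    intro p p' hne
    refine Set.disjoint_left.2 fun ω h1 h2 => hne ?_
    have h : ∀ j < m + 1, S p j = S p' j := fun j hj => (h1 j hj).symm.trans (h2 j hj)
    refine Prod.ext (by simpa [S, withLast] using h 0 m.succ_pos) (funext fun j => ?_)
    have := h (j + 1) (by omega)
    simpa [S, withLast, extendStr] using this
  calc μ (badEvent μ β γ K n m t) ≤ ∑' p, μ (A p ∩ E p) :=
        (measure_mono hsub).trans (measure_iUnion_le _)
    _ ≤ ∑' p, c * μ (A p) := ENNReal.tsum_le_tsum hAE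
    _ = c * ∑' p, μ (A p) := ENNReal.tsum_mul_left
    _ ≤ c * 1 := by
        gcongr
        rw [← measure_iUnion hd fun p => measurableSet_occursAt _ _ _]
        exact prob_le_one
    _ = c := mul_one c

lemma summable_sq_mul_exp_neg_rpow {δ : ℝ} (hδ : 0 < δ) :
    Summable fun n : ℕ => (n : ℝ) * (n * (2 * Real.exp (-(1 / 16) * (n : ℝ) ^ δ))) := by
  have h := (isLittleO_exp_neg_mul_rpow_atTop (a := 1 / 16) (by norm_num) (-4 / δ)).comp_tendsto
    ((tendsto_rpow_atTop hδ).comp tendsto_natCast_atTop_atTop)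
  refine summable_of_isBigO_nat (Real.summable_nat_rpow (p := -2).2 (by norm_num)) ?_
  refine Asymptotics.IsBigO.of_bound 2 ?_
  filter_upwards [h.bound one_pos, eventually_gt_atTop 0] with n hn hn0
  have hn' : (0 : ℝ) < n := by exact_mod_cast hn0
  simp only [Function.comp, one_mul, Real.norm_eq_abs, Real.abs_exp] at hn
  rw [← Real.rpow_mul hn'.le, mul_div_cancel₀ _ hδ.ne',
    abs_of_nonneg (Real.rpow_nonneg hn'.le _)] at hn
  have e : (n : ℝ) ^ (-2 : ℝ) = n * (n * (n : ℝ) ^ (-4 : ℝ)) := by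
    rw [← mul_assoc, ← sq, ← Real.rpow_natCast, ← Real.rpow_add hn']
    norm_num
  rw [Real.norm_of_nonneg (by positivity), Real.norm_of_nonneg (by positivity), e]
  calc _ ≤ (n : ℝ) * (n * (2 * (n : ℝ) ^ (-4 : ℝ))) := by gcongr
    _ = _ := by ring

/-- Almost surely only finitely many of the bad events occur. -/
lemma ae_eventually_notMem_badEvent (hμ : MeasurePreserving (shift : Path 𝒳 → Path 𝒳) μ μ)
    {β γ : ℝ} (hβ : 0 < β) (hβγ : 2 * β + γ < 1) :
    ∀ᵐ ω ∂μ, ∀ K : ℕ, ∀ᶠ n in atTop, ∀ m t, ω ∉ badEvent μ β γ K n m t := by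
  rw [ae_all_iff]
  intro K
  set B : ℕ → Set (Path 𝒳) := fun n =>
    ⋃ m ∈ Finset.range n, ⋃ t ∈ Finset.range n, badEvent μ β γ K n m t with hB
  have hBle : ∀ n, μ (B n) ≤ ENNReal.ofReal
      ((n : ℝ) * (n * (2 * Real.exp (-(1 / 16) * (n : ℝ) ^ (1 - γ - 2 * β))))) := by
    intro n
    refine (measure_biUnion_finset_le _ _).trans ?_
    refine (Finset.sum_le_sum fun m _ => (measure_biUnion_finset_le _ _).trans
      (Finset.sum_le_sum fun t _ => measure_badEvent_le hμ hβ K n m t)).trans (le_of_eq ?_)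
    simp only [Finset.sum_const, Finset.card_range, nsmul_eq_mul]
    rw [ENNReal.ofReal_mul (by positivity), ENNReal.ofReal_mul (by positivity),
      ENNReal.ofReal_mul (by positivity), ENNReal.ofReal_natCast, ENNReal.ofReal_ofNat]
  have hsum : ∑' n, μ (B n) ≠ ∞ :=
    ne_top_of_le_ne_top (summable_sq_mul_exp_neg_rpow (by linarith)).tsum_ofReal_ne_top
      (ENNReal.tsum_le_tsum hBle)
  filter_upwards [ae_eventually_notMem hsum] with ω hω
  filter_upwards [hω] with n hn m t hmem
  refine hn ?_
  have h1 := hmem.2.1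
  have h2 := hmem.2.2.1
  unfold half at h2
  simp only [hB, mem_iUnion, Finset.mem_range]
  exact ⟨m, by omega, t, by omega, hmem⟩

end BadEvents

section Estimator

variable {𝒳 : Type*}

lemma hatDelta_le {γ c : ℝ} {l : ℕ → ℕ} {ω : Path 𝒳} {n k : ℕ} (hc : 0 ≤ c)
    (h : ∀ i, 1 ≤ i → ∀ z x, inL γ ω n (k + i) (withLast x (prependOld (tildePast l ω) k z)) →
      |empCond ω n k x (tildePast l ω) -
        empCond ω n (k + i) x (prependOld (tildePast l ω) k z)| ≤ c) :
    hatDelta γ l ω n k ≤ c := by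
  unfold hatDelta
  split_ifs
  · rw [one_mul]
    refine Real.sSup_le ?_ hc
    rintro d ⟨i, hi, -, z, x, hL, rfl⟩
    exact h i hi z x hL
  · rwa [zero_mul]

lemma le_hatDelta {γ : ℝ} {l : ℕ → ℕ} {ω : Path 𝒳} {n k i : ℕ} {z : ℕ → 𝒳} {x : 𝒳}
    (hζ : zeta l ω (Jfun l k) ≤ (half n : ℤ) - 1) (hi : 1 ≤ i) (hin : i ≤ n)
    (hL : inL γ ω n (k + i) (withLast x (prependOld (tildePast l ω) k z))) :
    |empCond ω n k x (tildePast l ω) -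
      empCond ω n (k + i) x (prependOld (tildePast l ω) k z)| ≤ hatDelta γ l ω n k := by
  unfold hatDelta
  rw [if_pos hζ, one_mul]
  refine le_csSup ⟨1, ?_⟩ ⟨i, hi, hin, z, x, hL, rfl⟩
  rintro d ⟨i', -, -, z', x', ⟨⟨t, ht1, ht2, -⟩, -⟩, rfl⟩
  have hlen : half n + (k + i') ≤ n + 1 := by
    unfold half at ht2 ⊢
    omega
  have h1 := empCond_mem_Icc ω (by omega : half n + k ≤ n + 1) x' (tildePast l ω)
  have h2 := empCond_mem_Icc ω hlen x' (prependOld (tildePast l ω) k z')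
  rw [abs_le]
  constructor <;> linarith [h1.1, h1.2, h2.1, h2.2]

lemma chi_mem {γ β : ℝ} {l : ℕ → ℕ} {ω : Path 𝒳} {n : ℕ} (hn : 0 < n) :
    chi β γ l ω n < n ∧ hatDelta γ l ω n (chi β γ l ω n) ≤ (n : ℝ) ^ (-β) := by
  have hne : {k : ℕ | k < n ∧ hatDelta γ l ω n k ≤ (n : ℝ) ^ (-β)}.Nonempty := by
    refine ⟨n - 1, by omega, hatDelta_le (by positivity) fun i hi z x hL => ?_⟩
    obtain ⟨⟨t, ht1, ht2, -⟩, -⟩ := hL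
    unfold half at ht2
    omega
  exact Nat.sInf_mem hne

variable [MeasurableSpace 𝒳] [MeasurableSingletonClass 𝒳] {μ : Measure (Path 𝒳)}

lemma hatDelta_le_of_isMemoryBound (hμ : MeasurePreserving (shift : Path 𝒳 → Path 𝒳) μ μ)
    {β γ : ℝ} {l : ℕ → ℕ} {ω : Path 𝒳} {n K : ℕ}
    (hbad : ∀ m t, ω ∉ badEvent μ β γ K n m t) (hK : IsMemoryBound μ (tildePast l ω) K) :
    hatDelta γ l ω n K ≤ (n : ℝ) ^ (-β) := by
  refine hatDelta_le (by positivity) fun i hi z x hL => ?_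
  obtain ⟨⟨t, ht1, ht2, hocc⟩, hL2⟩ := hL
  lift t to ℕ using by omega
  set b := tildePast l ω
  have hb : ∀ j < K, b j = prependOld b K z j := fun j hj => by simp [prependOld, hj]
  have hσ := withLast_congr hb x
  have hshort : |empCond ω n K x b - pcond μ K x b| ≤ (n : ℝ) ^ (-β) / 2 := by
    by_contra! h
    refine hbad K t ⟨le_rfl, by omega, by omega, b, x, ?_, hK, ?_, h⟩
    · exact (occursAt_congr hσ _).2 (hocc.mono (by omega))
    · unfold inL2 at hL2 ⊢
      refine hL2.trans_le ?_
      rw [cnt_congr hσ]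
      exact_mod_cast cnt_mono_string _ (by omega) (by omega)
  have hlong : |empCond ω n (K + i) x (prependOld b K z) - pcond μ K x b| ≤
      (n : ℝ) ^ (-β) / 2 := by
    rw [pcond_congr hμ x hb]
    by_contra! h
    exact hbad (K + i) t ⟨by omega, by omega, by omega, prependOld b K z, x, hocc,
      hK.congr hμ hb, hL2, h⟩
  rw [abs_le] at *
  constructor <;> linarith [hshort.1, hshort.2, hlong.1, hlong.2]

lemma HasFrequencies.eventually_lt_hatDelta [IsFiniteMeasure μ] {ω : Path 𝒳}
    (h : HasFrequencies μ ω) (hμ : MeasurePreserving (shift : Path 𝒳 → Path 𝒳) μ μ) {β γ : ℝ}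
    (hβ : 0 < β) (hγ : 0 < γ) {l : ℕ → ℕ} {k : ℕ} (hk : ¬ IsMemoryBound μ (tildePast l ω) k) :
    ∀ᶠ n : ℕ in atTop, (n : ℝ) ^ (-β) < hatDelta γ l ω n k := by
  unfold IsMemoryBound at hk
  push Not at hk
  obtain ⟨i, hi, y, z, hpos, hne⟩ := hk
  set b := tildePast l ω
  have hlong : 0 < pstr μ (k + i) (prependOld b k z) := hpos.trans_le (pstr_withLast_le hμ _ _ _)
  have hshort : 0 < pstr μ k b := by
    have hb : ∀ j < k, b j = prependOld b k z j := fun j hj => by simp [prependOld, hj]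
    refine hlong.trans_le ?_
    rw [pstr_congr μ hb, pstr_eq, pstr_eq]
    exact measureReal_mono fun ω' hω' => OccursAt.mono hω' (by omega)
  have hlim := ((h.tendsto_empCond hμ y hshort).sub (h.tendsto_empCond hμ y hlong)).abs
  have h0 : Tendsto (fun n : ℕ => (n : ℝ) ^ (-β)) atTop (𝓝 0) :=
    (tendsto_rpow_neg_atTop hβ).comp tendsto_natCast_atTop_atTop
  filter_upwards [h0.eventually_lt hlim (abs_pos.2 (sub_ne_zero.2 hne)),
    h.eventually_inL hγ hpos, eventually_ge_atTop i,
    eventually_ge_atTop (2 * ((zeta l ω (Jfun l k)).toNat + 1))] with n hn hL hin hζ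
  refine hn.trans_le (le_hatDelta ?_ hi hin hL)
  unfold half
  omega

end Estimator

lemma memLen_cases {𝒳 : Type*} [MeasurableSpace 𝒳] (μ : Measure (Path 𝒳)) (b : ℕ → 𝒳) :
    (memLen μ b = ⊤ ∧ ∀ k, ¬ IsMemoryBound μ b k) ∨
      ∃ K : ℕ, memLen μ b = K ∧ IsMemoryBound μ b K ∧ ∀ k < K, ¬ IsMemoryBound μ b k := by
  by_cases hne : ∃ K, IsMemoryBound μ b K
  · obtain ⟨K, hK⟩ := hne
    have hmem := csInf_mem (s := {n : ℕ∞ | ∃ K : ℕ, n = (K : ℕ∞) ∧ IsMemoryBound μ b K})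
      ⟨K, K, rfl, hK⟩
    obtain ⟨M, hM, hMb⟩ := hmem
    refine .inr ⟨M, hM, hMb, fun k hk hkb => ?_⟩
    have hle : memLen μ b ≤ k := sInf_le ⟨k, rfl, hkb⟩
    rw [memLen, hM] at hle
    exact absurd (by exact_mod_cast hle : M ≤ k) (by omega)
  · push Not at hne
    refine .inl ⟨?_, hne⟩
    rw [memLen, sInf_eq_top]
    rintro _ ⟨K, -, hK⟩
    exact absurd hK (hne K)

/-- Step 2. Almost surely, on `{K(X̃⁰_{-∞}) < ∞}` the
estimate `χ_n` equals `K(X̃⁰_{-∞})` eventually, and on `{K(X̃⁰_{-∞}) = ∞}` one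
has `χ_n → ∞`. -/
theorem statement9
    {𝒳 : Type*} [Countable 𝒳] [MeasurableSpace 𝒳] [MeasurableSingletonClass 𝒳]
    (μ : Measure (Path 𝒳)) [IsProbabilityMeasure μ]
    (hErg : Ergodic (shift : Path 𝒳 → Path 𝒳) μ)
    (l : ℕ → ℕ) (hl1 : l 1 = 1) (hlmono : Monotone l)
    (hlle : ∀ k, 1 ≤ k → l k ≤ k) (hltop : Tendsto l atTop atTop)
    (β γ : ℝ) (hγ0 : 0 < γ) (hγ1 : γ < 1) (hβ0 : 0 < β) (hβγ : 2 * β + γ < 1) :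
    ∀ᵐ ω ∂μ,
      (memLen μ (tildePast l ω) ≠ ⊤ →
        ∀ᶠ n in atTop, chi β γ l ω n = (memLen μ (tildePast l ω)).toNat) ∧
      (memLen μ (tildePast l ω) = ⊤ →
        Tendsto (fun n => chi β γ l ω n) atTop atTop) := by
  have hμ := hErg.toMeasurePreserving
  filter_upwards [ae_hasFrequencies hErg,
    ae_eventually_notMem_badEvent (γ := γ) hμ hβ0 hβγ] with ω hfreq hbad
  have hlt : ∀ N : ℕ, (∀ k < N, ¬ IsMemoryBound μ (tildePast l ω) k) →
      ∀ᶠ n in atTop, N ≤ chi β γ l ω n := by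
    intro N hN
    have hall : ∀ᶠ n : ℕ in atTop, ∀ k ∈ Finset.range N,
        (n : ℝ) ^ (-β) < hatDelta γ l ω n k :=
      (eventually_all_finset _).2 fun k hk =>
        hfreq.eventually_lt_hatDelta hμ hβ0 hγ0 (hN k (Finset.mem_range.1 hk))
    filter_upwards [hall, eventually_gt_atTop 0] with n hn hn0
    by_contra! hchi
    exact (hn _ (Finset.mem_range.2 hchi)).not_ge (chi_mem hn0).2
  rcases memLen_cases μ (tildePast l ω) with ⟨htop, hnone⟩ | ⟨K, hKeq, hK, hmin⟩
  · exact ⟨fun h => absurd htop h, fun _ => tendsto_atTop.2 fun N => hlt N fun k _ => hnone k⟩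
  · rw [hKeq]
    refine ⟨fun _ => ?_, fun h => absurd h (ENat.natCast_ne_top K)⟩
    filter_upwards [hlt K hmin, hbad K, eventually_gt_atTop K] with n hn hbadn hKn
    rw [ENat.toNat_natCast]
    exact le_antisymm (Nat.sInf_le ⟨hKn, hatDelta_le_of_isMemoryBound hμ hbadn hK⟩) hn

end MWPrediction
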